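/- arXiv:1503.03286 — 3 statements merged into one kernel-verified Lean document; each statement's English description precedes it below -/
import Mathlib

section
/- Let α be irrational with continued-fraction denominators (q_k), and let t, t', u ∈ S¹. If the four-jump cocycle φ^u_{t,t'} is not ergodic, then lim_{k→∞} min{ ‖q_k·(t−t')‖, ‖q_k·(t+t')‖ } = 0. -/
open MeasureTheory Filter Topology

noncomputable section

/-- The skew product `T_φ(s,κ) = (s+α, κ·φ(s))` on `S¹ × {−1,1}`, where `{−1,1}` is
modelled as `ℤˣ`. -/
def skewProd (α : ℝ) (φ : UnitAddCircle → ℤˣ) :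
    UnitAddCircle × ℤˣ → UnitAddCircle × ℤˣ :=
  fun p => (p.1 + (α : UnitAddCircle), p.2 * φ p.1)

/-- The uniform (Haar) probability measure on `{−1,1} = ℤˣ`. -/
def uniformZ2 : Measure ℤˣ := (2 : ENNReal)⁻¹ • Measure.count

/-- The product of the Haar (Lebesgue) probability measure on `S¹` with the uniform
measure on `{−1,1}`. -/
def prodMeas : Measure (UnitAddCircle × ℤˣ) := (volume : Measure UnitAddCircle).prod uniformZ2

/-- The two-jump cocycle `φ_t`, equal to `−1` on the arc `[0,t)` and `1` elsewhere
(a point of `S¹` is identified with its representative in `[0,1)`). -/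
def phiT (t : ℝ) (s : UnitAddCircle) : ℤˣ :=
  if ((AddCircle.equivIco 1 0 s : Set.Ico (0 : ℝ) (0 + 1)) : ℝ) < t then -1 else 1

/-- The four-jump cocycle `φ^u_{t,t'}(s) = φ_t(s)·φ_{t'}(s+u)`. -/
def phi4 (t t' u : ℝ) (s : UnitAddCircle) : ℤˣ :=
  phiT t s * phiT t' (s + (u : UnitAddCircle))

/-- `‖x‖`: the distance of a real number to the nearest integer. -/
def distInt (x : ℝ) : ℝ := |x - (round x : ℤ)|

/-- The sequence of denominators of the continued fraction expansion of `α`. -/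
def cfDen (α : ℝ) (k : ℕ) : ℝ := (GenContFract.of α).dens k

/-- Over an irrational number every continued fraction step is available. -/
theorem not_terminatedAt_of_irrational {α : ℝ} (hα : Irrational α) (n : ℕ) :
    ¬(GenContFract.of α).TerminatedAt n := fun h => by
  obtain ⟨r, hr⟩ := (GenContFract.terminates_iff_rat α).1 ⟨n, h⟩
  exact hα ⟨r, hr.symm⟩

theorem exists_int_eq_contsAux {α : ℝ} (hα : Irrational α) (n : ℕ) :
    (∃ a b : ℤ, ((GenContFract.of α).contsAux n).a = a ∧
      ((GenContFract.of α).contsAux n).b = b) ∧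
    (∃ a b : ℤ, ((GenContFract.of α).contsAux (n + 1)).a = a ∧
      ((GenContFract.of α).contsAux (n + 1)).b = b) := by
  induction n with
  | zero =>
    refine ⟨⟨1, 0, ?_, ?_⟩, ⟨⌊α⌋, 1, ?_, ?_⟩⟩ <;> simp [GenContFract.contsAux]
  | succ n ih =>
    refine ⟨ih.2, ?_⟩
    obtain ⟨⟨a, b, ha, hb⟩, ⟨c, d, hc, hd⟩⟩ := ih
    obtain ⟨gp, hgp⟩ : ∃ gp, (GenContFract.of α).s.get? n = some gp :=
      Option.ne_none_iff_exists'.1 (not_terminatedAt_of_irrational hα n)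
    obtain ⟨h1, z, hz⟩ := GenContFract.of_partNum_eq_one_and_exists_int_partDen_eq hgp
    refine ⟨z * c + a, z * d + b, ?_, ?_⟩
    · rw [GenContFract.contsAux_recurrence hgp rfl rfl, h1, hz, hc, ha]
      push_cast; ring
    · rw [GenContFract.contsAux_recurrence hgp rfl rfl, h1, hz, hd, hb]
      push_cast; ring

theorem tendsto_cfDen_atTop {α : ℝ} (hα : Irrational α) : Tendsto (cfDen α) atTop atTop := by
  have hfib : Tendsto (fun k : ℕ => ((k + 1).fib : ℝ)) atTop atTop := by
    refine tendsto_natCast_atTop_atTop.comp ?_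
    refine tendsto_atTop_mono' atTop ?_ (tendsto_id (α := ℕ))
    filter_upwards [eventually_ge_atTop 5] with k hk
    exact (Nat.le_fib_self hk).trans Nat.fib_le_fib_succ
  exact tendsto_atTop_mono (fun k => GenContFract.succ_nth_fib_le_of_nth_den
    (Or.inr (not_terminatedAt_of_irrational hα _))) hfib

theorem cfDen_eq_natCast {α : ℝ} (hα : Irrational α) (k : ℕ) :
    ∃ (q : ℕ) (p : ℤ), cfDen α k = q ∧ 0 < q ∧ IsCoprime p q ∧
      |q * α - p| ≤ 1 / (q : ℝ) := by
  obtain ⟨⟨a, b, ha, hb⟩, ⟨c, d, hc, hd⟩⟩ := exists_int_eq_contsAux hα (k + 1)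
  have hnum : (GenContFract.of α).nums k = a := ha
  have hden : (GenContFract.of α).dens k = b := hb
  have hnum' : (GenContFract.of α).nums (k + 1) = c := hc
  have hden' : (GenContFract.of α).dens (k + 1) = d := hd
  have hdet := SimpContFract.determinant (s := SimpContFract.of α)
    (not_terminatedAt_of_irrational hα k)
  have hpos : (0 : ℝ) < b := by
    rw [← hden]
    refine lt_of_lt_of_le ?_ (GenContFract.succ_nth_fib_le_of_nth_den
      (Or.inr (not_terminatedAt_of_irrational hα _)))
    exact_mod_cast Nat.fib_pos.2 (Nat.succ_pos k)
  have hb0 : 0 < b := by exact_mod_cast hpos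
  lift b to ℕ using hb0.le
  refine ⟨b, a, by simpa [cfDen] using hden, by exact_mod_cast hb0, ?_, ?_⟩
  · have hZ : a * d - (b : ℤ) * c = (-1) ^ (k + 1) := by
      change (GenContFract.of α).nums k * (GenContFract.of α).dens (k + 1) -
        (GenContFract.of α).dens k * (GenContFract.of α).nums (k + 1) = _ at hdet
      rw [hnum, hden, hnum', hden'] at hdet
      exact_mod_cast hdet
    have hsq : ((-1 : ℤ) ^ (k + 1)) * (-1) ^ (k + 1) = 1 := by
      rw [← mul_pow]; norm_num
    refine ⟨d * (-1) ^ (k + 1), -c * (-1) ^ (k + 1), ?_⟩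
    linear_combination (-1) ^ (k + 1) * hZ + hsq
  · have happ := GenContFract.abs_sub_convs_le (not_terminatedAt_of_irrational hα k)
    have hmono := GenContFract.of_den_mono (v := α) (n := k)
    rw [GenContFract.conv_eq_num_div_den, hnum, hden, hden'] at happ
    rw [hden, hden'] at hmono
    push_cast at *
    have hd0 : (0 : ℝ) < d := hpos.trans_le hmono
    have : (b : ℝ) * α - a = b * (α - a / b) := by field_simp
    rw [this, abs_mul, abs_of_pos hpos]
    calc (b : ℝ) * |α - a / b| ≤ b * (1 / (b * d)) := by gcongr
      _ = 1 / d := by field_simp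
      _ ≤ 1 / b := by gcongr

/-- Multiples of `α` by integers smaller than a denominator stay away from `0`. -/
theorem le_norm_nsmul_of_coprime {α : ℝ} {q m : ℕ} {p : ℤ} (hcop : IsCoprime p q)
    (happ : |q * α - p| ≤ 1 / (q : ℝ)) (hm : 0 < m) (hmq : m < q) :
    1 / (q : ℝ) - m / (q : ℝ) ^ 2 ≤ ‖m • (α : UnitAddCircle)‖ := by
  have hq : (0 : ℝ) < q := by exact_mod_cast hm.trans hmq
  rw [← AddCircle.coe_nsmul, UnitAddCircle.norm_eq]
  generalize round (m • α) = n
  have hne : (m : ℤ) * p - n * q ≠ 0 := by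
    intro h
    have hdvd : (q : ℤ) ∣ m * p := ⟨n, by linarith⟩
    have := hcop.symm.dvd_of_dvd_mul_right hdvd
    have := Nat.le_of_dvd hm (by exact_mod_cast this)
    omega
  have h1 : (1 : ℝ) ≤ |(m : ℝ) * p - n * q| := by
    have := Int.one_le_abs hne
    exact_mod_cast this
  have h2 : (m : ℝ) * p - n * q = q * (m * α - n) - m * (q * α - p) := by ring
  have h3 : |(m : ℝ) * p - n * q| ≤ q * |m * α - n| + m * (1 / q) := by
    rw [h2]
    refine (abs_sub _ _).trans ?_
    rw [abs_mul, abs_mul, abs_of_pos hq, abs_of_nonneg (Nat.cast_nonneg m : (0 : ℝ) ≤ m)]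
    gcongr
  rw [nsmul_eq_mul]
  have h4 : 1 - m / (q : ℝ) ≤ |m * α - n| * q := by
    have : (m : ℝ) * (1 / q) = m / q := by ring
    linarith
  calc 1 / (q : ℝ) - m / (q : ℝ) ^ 2 = (1 - m / (q : ℝ)) / q := by field_simp
    _ ≤ |m * α - n| := by rwa [div_le_iff₀ hq]

theorem norm_nsmul_le_of_abs_sub_le {α : ℝ} {q : ℕ} {p : ℤ}
    (happ : |q * α - p| ≤ 1 / (q : ℝ)) : ‖q • (α : UnitAddCircle)‖ ≤ 1 / (q : ℝ) := by
  rw [← AddCircle.coe_nsmul, UnitAddCircle.norm_eq]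
  exact (round_le _ p).trans (by simpa using happ)

/-- Four points of a normed group, each of which is close to another one, can be paired up. -/
theorem min_norm_le_of_forall_exists_close {G : Type*} [SeminormedAddCommGroup G] (a b v : G)
    {δ : ℝ} (X : Fin 4 → G) (hX : X = ![0, a, -v, b - v])
    (h : ∀ i, ∃ j, j ≠ i ∧ ‖X j - X i‖ ≤ δ) :
    min ‖a - b‖ ‖a + b‖ ≤ 4 * δ := by
  have tri : ∀ i j k, ‖X i - X k‖ ≤ ‖X i - X j‖ + ‖X j - X k‖ := fun i j k =>
    norm_sub_le_norm_sub_add_norm_sub _ _ _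
  have symm : ∀ i j, ‖X i - X j‖ = ‖X j - X i‖ := fun i j => norm_sub_rev _ _
  have e1 : ‖a - b‖ ≤ ‖X 2 - X 0‖ + ‖X 3 - X 1‖ := by
    have : a - b = (X 2 - X 0) - (X 3 - X 1) := by simp [hX]; abel
    rw [this]; exact norm_sub_le _ _
  have e2 : ‖a - b‖ ≤ ‖X 1 - X 0‖ + ‖X 3 - X 2‖ := by
    have : a - b = (X 1 - X 0) - (X 3 - X 2) := by simp [hX]
    rw [this]; exact norm_sub_le _ _
  have e3 : ‖a + b‖ ≤ ‖X 3 - X 0‖ + ‖X 2 - X 1‖ := by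
    have : a + b = (X 3 - X 0) - (X 2 - X 1) := by simp [hX]; abel
    rw [this]; exact norm_sub_le _ _
  obtain ⟨j0, n0, d0⟩ := h 0
  obtain ⟨j1, n1, d1⟩ := h 1
  obtain ⟨j2, n2, d2⟩ := h 2
  obtain ⟨j3, n3, d3⟩ := h 3
  have s02 := symm 0 2
  have s03 := symm 0 3
  have s12 := symm 1 2
  have s13 := symm 1 3
  have s23 := symm 2 3
  have hδ : 0 ≤ δ := (norm_nonneg _).trans d0
  have t1 := tri 3 0 1
  have t3 := tri 3 1 0
  have t5 := tri 3 2 0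
  have t10 := tri 1 3 0
  rw [min_le_iff]
  fin_cases j0 <;> fin_cases j1 <;> fin_cases j2 <;> fin_cases j3 <;>
    simp only [ne_eq, not_true_eq_false, Fin.reduceFinMk, Fin.zero_eta, Fin.mk_one] at n0 n1 n2 n3 d0 d1 d2 d3 <;>
    first
      | (left; linarith)
      | (right; linarith)

/-- The points `s` of the circle such that `x` lies on the arc `(s, s + h]`. -/
def jumpArc (h : ℝ) (x : UnitAddCircle) : Set UnitAddCircle :=
  {s | ∃ r ∈ Set.Ioc 0 h, (r : UnitAddCircle) = x - s}

theorem norm_sub_lt_of_mem_jumpArc {h : ℝ} {x y s s' : UnitAddCircle} (hs : s ∈ jumpArc h x)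
    (hs' : s' ∈ jumpArc h y) : ‖(y - s') - (x - s)‖ < h := by
  obtain ⟨r, hr, e⟩ := hs
  obtain ⟨r', hr', e'⟩ := hs'
  rw [← e, ← e', ← AddCircle.coe_sub, UnitAddCircle.norm_eq]
  refine (round_le _ 0).trans_lt ?_
  rw [Int.cast_zero, sub_zero, abs_lt]
  constructor <;> linarith [hr.1, hr.2, hr'.1, hr'.2]

theorem closedBall_subset_jumpArc {h : ℝ} (h0 : 0 < h) (x : UnitAddCircle) :
    Metric.closedBall (x - ((h / 2 : ℝ) : UnitAddCircle)) (h / 4) ⊆ jumpArc h x := by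
  intro s hs
  obtain ⟨σ, rfl⟩ := QuotientAddGroup.mk_surjective s
  obtain ⟨ξ, rfl⟩ := QuotientAddGroup.mk_surjective x
  rw [Metric.mem_closedBall, dist_eq_norm, ← AddCircle.coe_sub, ← AddCircle.coe_sub,
    UnitAddCircle.norm_eq] at hs
  generalize round (σ - (ξ - h / 2)) = n at hs
  rw [abs_le] at hs
  refine ⟨ξ - σ + n, ⟨by linarith, by linarith⟩, ?_⟩
  have : ((n : ℝ) : UnitAddCircle) = 0 := AddCircle.coe_eq_zero_iff 1 |>.2 ⟨n, by simp⟩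
  rw [AddCircle.coe_add, this, add_zero, AddCircle.coe_sub]

theorem coe_mem_jumpArc_iff {σ t h : ℝ} (hσ : σ ∈ Set.Ico (0 : ℝ) 1)
    (ht : t ∈ Set.Ico (0 : ℝ) 1) (h1 : h < 1) :
    (σ : UnitAddCircle) ∈ jumpArc h t ↔ (σ < t ∧ t ≤ σ + h) ∨ t + 1 ≤ σ + h := by
  obtain ⟨hσ0, hσ1⟩ := hσ
  obtain ⟨ht0, ht1⟩ := ht
  constructor
  · rintro ⟨r, ⟨hr0, hr⟩, e⟩
    rw [← AddCircle.coe_sub, ← sub_eq_zero, ← AddCircle.coe_sub, AddCircle.coe_eq_zero_iff] at e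
    obtain ⟨n, hn⟩ := e
    rw [zsmul_eq_mul, mul_one] at hn
    have hn1 : n < 2 := by
      have : (n : ℝ) < 2 := by linarith
      exact_mod_cast this
    have hn2 : -1 < n := by
      have : (-1 : ℝ) < n := by linarith
      exact_mod_cast this
    obtain rfl | rfl : n = 0 ∨ n = 1 := by omega
    · left; constructor <;> push_cast at hn <;> linarith
    · right; push_cast at hn; linarith
  · rintro (⟨a, b⟩ | a)
    · exact ⟨t - σ, ⟨by linarith, by linarith⟩, AddCircle.coe_sub ..⟩
    · refine ⟨t + 1 - σ, ⟨by linarith, by linarith⟩, ?_⟩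
      rw [AddCircle.coe_sub, AddCircle.coe_add, AddCircle.coe_period, add_zero]

theorem phiT_coe (t : ℝ) {σ : ℝ} (hσ : σ ∈ Set.Ico (0 : ℝ) 1) :
    phiT t (σ : UnitAddCircle) = if σ < t then -1 else 1 := by
  have : ((AddCircle.equivIco 1 0 (σ : UnitAddCircle) : Set.Ico (0 : ℝ) (0 + 1)) : ℝ) = σ := by
    rw [AddCircle.equivIco_coe_eq (by simpa using hσ)]
  rw [phiT, this]

open Classical in
/-- The factor that a jump at `x` contributes when passing from `s` to `s + h`. -/
def jumpSign (h : ℝ) (x s : UnitAddCircle) : ℤˣ := if s ∈ jumpArc h x then -1 else 1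

theorem phiT_add_mul_phiT {t h : ℝ} (ht : t ∈ Set.Ico (0 : ℝ) 1) (h0 : 0 < h) (h1 : h < 1)
    (s : UnitAddCircle) :
    phiT t (s + h) * phiT t s = jumpSign h 0 s * jumpSign h t s := by
  obtain ⟨σ, hσ, rfl⟩ : ∃ σ ∈ Set.Ico (0 : ℝ) 1, (σ : UnitAddCircle) = s :=
    ⟨AddCircle.equivIco 1 0 s, by simpa using (AddCircle.equivIco 1 0 s).2,
      (AddCircle.equivIco 1 0).symm_apply_apply s⟩
  have hzero : (σ : UnitAddCircle) ∈ jumpArc h 0 ↔ 1 ≤ σ + h := by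
    have := coe_mem_jumpArc_iff hσ (t := 0) ⟨le_rfl, one_pos⟩ h1
    rw [AddCircle.coe_zero] at this
    rw [this]
    have := hσ.1
    constructor
    · rintro (⟨a, -⟩ | a) <;> linarith
    · intro a; right; linarith
  simp only [jumpSign, hzero, coe_mem_jumpArc_iff hσ ht h1, phiT_coe t hσ]
  obtain ⟨hσ0, hσ1⟩ := hσ
  obtain ⟨ht0, ht1⟩ := ht
  rw [← AddCircle.coe_add]
  by_cases hw : σ + h < 1
  · rw [phiT_coe t ⟨by linarith, hw⟩]
    split_ifs <;> first | rfl | (exfalso; grind)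
  · have : ((σ + h : ℝ) : UnitAddCircle) = ((σ + h - 1 : ℝ) : UnitAddCircle) := by
      rw [AddCircle.coe_sub, AddCircle.coe_period, sub_zero]
    rw [this, phiT_coe t ⟨by linarith, by linarith⟩]
    split_ifs <;> first | rfl | (exfalso; grind)

theorem jumpSign_add_right (h : ℝ) (x s u : UnitAddCircle) :
    jumpSign h x (s + u) = jumpSign h (x - u) s := by
  have : s + u ∈ jumpArc h x ↔ s ∈ jumpArc h (x - u) := by
    simp only [jumpArc, Set.mem_ofPred_eq, show x - (s + u) = x - u - s by abel]
  classical exact if_congr this rfl rfl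

theorem phi4_add_mul_phi4 {t t' u h : ℝ} (ht : t ∈ Set.Ico (0 : ℝ) 1)
    (ht' : t' ∈ Set.Ico (0 : ℝ) 1) (h0 : 0 < h) (h1 : h < 1) (s : UnitAddCircle) :
    phi4 t t' u (s + h) * phi4 t t' u s =
      ∏ i, jumpSign h ((![0, (t : UnitAddCircle), -u, t' - u] : Fin 4 → UnitAddCircle) i) s := by
  have e := phiT_add_mul_phiT ht h0 h1 s
  have e' := phiT_add_mul_phiT ht' h0 h1 (s + u)
  rw [jumpSign_add_right, jumpSign_add_right, zero_sub] at e'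
  simp only [Fin.prod_univ_four, Matrix.cons_val]
  rw [mul_assoc, ← e', ← e, phi4, phi4, add_right_comm s (h : UnitAddCircle), mul_mul_mul_comm]

theorem card_mul_measure_le_of_translates {S E : Set UnitAddCircle} (hS : MeasurableSet S)
    (a : UnitAddCircle) (J : Finset ℕ) (hE : ∀ j ∈ J, ∀ s ∈ S, s + j • a ∈ E)
    (hdisj : ∀ i ∈ J, ∀ j ∈ J, i < j → ∀ s ∈ S, ∀ s' ∈ S, s + i • a ≠ s' + j • a) :
    J.card * volume S ≤ volume E := by
  have hm : ∀ j : ℕ, volume ((fun x => x - j • a) ⁻¹' S) = volume S := fun j =>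
    (measurePreserving_sub_right volume (j • a)).measure_preimage hS.nullMeasurableSet
  calc J.card * volume S = ∑ j ∈ J, volume ((fun x => x - j • a) ⁻¹' S) := by
        simp [hm]
    _ = volume (⋃ j ∈ J, (fun x => x - j • a) ⁻¹' S) := by
        refine (measure_biUnion_finset ?_ fun j _ => hS.preimage (by fun_prop)).symm
        intro i hi j hj hij
        rw [Function.onFun, Set.disjoint_left]
        intro x hxi hxj
        rcases lt_or_gt_of_ne hij with hlt | hlt
        · exact hdisj i hi j hj hlt _ hxi _ hxj (by simp)
        · exact hdisj j hj i hi hlt _ hxj _ hxi (by simp)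
    _ ≤ volume E := by
        refine measure_mono (Set.iUnion₂_subset fun j hj x hx => ?_)
        simpa using hE j hj _ hx

/-- A jump that no other jump approaches along short orbit pieces makes the transfer set `B`
differ from its translate by `h` on a set of large measure. -/
theorem mul_le_measure_of_isolated_jump {ι : Type*} [Fintype ι]
    {φ : UnitAddCircle → ℤˣ} {a : UnitAddCircle} {h : ℝ} {X : ι → UnitAddCircle}
    (h0 : 0 < h) (h1 : h < 1) (hφ : ∀ s, φ (s + h) * φ s = ∏ i, jumpSign h (X i) s)
    {B C : Set UnitAddCircle} (hB : MeasurableSet B) (hC : MeasurableSet C)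
    (hC0 : volume Cᶜ = 0)
    (hBC : ∀ s ∈ C, s + a ∈ C ∧ (s + a ∈ B ↔ (s ∈ B ↔ φ s = 1)))
    {N : ℕ} {i₀ : ι}
    (hiso : ∀ j ≠ i₀, ∀ m : ℤ, |m| ≤ N → h ≤ ‖X j - X i₀ - m • a‖)
    (hret : ∀ m : ℕ, 0 < m → m ≤ 2 * N → h ≤ ‖m • a‖) :
    N * ENNReal.ofReal (h / 2) ≤
      2 * volume {s : UnitAddCircle | ¬(s + (h : UnitAddCircle) ∈ B ↔ s ∈ B)} := by
  classical
  set E := {s : UnitAddCircle | ¬(s + (h : UnitAddCircle) ∈ B ↔ s ∈ B)} with hEdef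
  set D : Set UnitAddCircle := {s | s ∈ C ∧ s + (h : UnitAddCircle) ∈ C} with hDdef
  have hadd : ∀ c : UnitAddCircle, Measurable fun s : UnitAddCircle => s + c := fun c => by
    fun_prop
  have hEm : MeasurableSet E :=
    (((hadd _) hB).iff hB).compl
  have hDm : MeasurableSet D := hC.inter ((hadd _) hC)
  have hD0 : volume Dᶜ = 0 := by
    have : Dᶜ = Cᶜ ∪ (fun s => s + (h : UnitAddCircle)) ⁻¹' Cᶜ := by
      ext s; simp [hDdef]; tauto
    rw [this, measure_union_null_iff]
    refine ⟨hC0, ?_⟩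
    rw [(measurePreserving_add_right volume _).measure_preimage hC.compl.nullMeasurableSet, hC0]
  have hstep : ∀ s ∈ D, s + a ∈ D ∧ (s + a ∈ E ↔ (s ∈ E ↔ φ (s + h) * φ s = 1)) := by
    rintro s ⟨hs, hs'⟩
    obtain ⟨k1, k2⟩ := hBC s hs
    obtain ⟨k3, k4⟩ := hBC _ hs'
    rw [add_right_comm] at k3 k4
    refine ⟨⟨k1, k3⟩, ?_⟩
    simp only [hEdef, Set.mem_ofPred_eq, k2, k4]
    rcases Int.units_eq_one_or (φ s) with e | e <;>
      rcases Int.units_eq_one_or (φ (s + h)) with e' | e' <;> simp [e, e'] <;> tauto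
  set L : Set UnitAddCircle := (fun s => s + N • a) ⁻¹'
    Metric.closedBall (X i₀ - ((h / 2 : ℝ) : UnitAddCircle)) (h / 4) with hL
  have hLm : MeasurableSet L := (hadd _) Metric.isClosed_closedBall.measurableSet
  have hLvol : volume L = ENNReal.ofReal (h / 2) := by
    rw [hL, (measurePreserving_add_right volume _).measure_preimage
      Metric.isClosed_closedBall.measurableSet.nullMeasurableSet, AddCircle.volume_closedBall]
    congr 1
    rw [min_eq_right (by linarith)]; ring
  have hLarc : ∀ s ∈ L, s + N • a ∈ jumpArc h (X i₀) := fun s hs =>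
    closedBall_subset_jumpArc h0 _ hs
  have hmem : ∀ s ∈ L, ∀ j ≤ 2 * N, ∀ i, s + j • a ∈ jumpArc h (X i) ↔ i = i₀ ∧ j = N := by
    intro s hs j hj i
    refine ⟨fun hi => ?_, fun ⟨hi, hjN⟩ => hi ▸ hjN ▸ hLarc s hs⟩
    have hlt := norm_sub_lt_of_mem_jumpArc (hLarc s hs) hi
    have e : X i - (s + j • a) - (X i₀ - (s + N • a)) = X i - X i₀ - ((j : ℤ) - N) • a := by
      rw [sub_smul, natCast_zsmul, natCast_zsmul]; abel
    rw [e] at hlt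
    have hi' : i = i₀ := by
      by_contra hne
      exact absurd (hiso i hne _ (by rw [abs_le]; constructor <;> omega)) (not_le.2 hlt)
    refine ⟨hi', ?_⟩
    subst hi'
    rw [sub_self, zero_sub, norm_neg] at hlt
    by_contra hne
    rcases lt_or_gt_of_ne hne with hl | hl
    · have := hret (N - j) (by omega) (by omega)
      rw [← neg_sub, neg_smul, norm_neg, ← Nat.cast_sub hl.le, natCast_zsmul] at hlt
      linarith
    · have := hret (j - N) (by omega) (by omega)
      rw [← Nat.cast_sub hl.le, natCast_zsmul] at hlt
      linarith
  have hval : ∀ s ∈ L, ∀ j ≤ 2 * N,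
      (φ (s + j • a + h) * φ (s + j • a) = 1 ↔ j ≠ N) := by
    intro s hs j hj
    rw [hφ]
    simp only [jumpSign, hmem s hs j hj]
    by_cases hjN : j = N <;> simp [hjN]
  have horbit : ∀ s ∈ L ∩ D, ∀ j ≤ 2 * N, s + j • a ∈ D ∧ (s + j • a ∈ E ↔ (s ∈ E ↔ j ≤ N)) := by
    rintro s ⟨hsL, hsD⟩ j
    induction j with
    | zero => intro _; simpa using hsD
    | succ j ih =>
      intro hj
      obtain ⟨i1, i2⟩ := ih (by omega)
      obtain ⟨i3, i4⟩ := hstep _ i1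
      rw [hval s hsL j (by omega), i2] at i4
      rw [succ_nsmul, ← add_assoc]
      refine ⟨i3, i4.trans ?_⟩
      rcases lt_trichotomy j N with hl | hl | hl
      · simp [hl.le, hl.ne, Nat.succ_le_of_lt hl]
      · simp [hl]
      · simp [hl.ne', not_le.2 hl, not_le.2 (hl.trans (Nat.lt_succ_self _))]
  have hdis : ∀ i j : ℕ, j ≤ 2 * N → i < j → ∀ s ∈ L, ∀ s' ∈ L, s + i • a ≠ s' + j • a := by
    intro i j hj hij s hs s' hs' e
    have hlt := norm_sub_lt_of_mem_jumpArc (hLarc s hs) (hLarc s' hs')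
    have e' : X i₀ - (s' + N • a) - (X i₀ - (s + N • a)) = (j - i) • a := by
      rw [sub_nsmul _ hij.le]
      have : s = s' + j • a - i • a := by rw [← e]; abel
      rw [this]; abel
    rw [e'] at hlt
    exact absurd (hret (j - i) (by omega) (by omega)) (not_le.2 hlt)
  have b1 : N * volume (L ∩ D ∩ E) ≤ volume E := by
    have := card_mul_measure_le_of_translates (E := E) ((hLm.inter hDm).inter hEm) a
      (Finset.Icc 1 N)
      (fun j hj s hs => by
        rw [Finset.mem_Icc] at hj
        rw [(horbit s hs.1 j (by omega)).2]
        simp [hs.2, hj.2])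
      (fun i hi j hj hij s hs s' hs' => by
        rw [Finset.mem_Icc] at hj
        exact hdis i j (by omega) hij s hs.1.1 s' hs'.1.1)
    simpa using this
  have b2 : N * volume ((L ∩ D) \ E) ≤ volume E := by
    have := card_mul_measure_le_of_translates (E := E) ((hLm.inter hDm).diff hEm) a
      (Finset.Ioc N (2 * N))
      (fun j hj s hs => by
        rw [Finset.mem_Ioc] at hj
        rw [(horbit s hs.1 j (by omega)).2]
        simp [hs.2, hj.1])
      (fun i hi j hj hij s hs s' hs' => by
        rw [Finset.mem_Ioc] at hj
        exact hdis i j (by omega) hij s hs.1.1 s' hs'.1.1)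
    simpa [two_mul] using this
  have hLD : volume (L ∩ D) = volume L := measure_inter_conull hD0
  calc (N : ENNReal) * ENNReal.ofReal (h / 2)
      = N * (volume (L ∩ D ∩ E) + volume ((L ∩ D) \ E)) := by
        rw [measure_inter_add_sdiff _ hEm, hLD, hLvol]
    _ = N * volume (L ∩ D ∩ E) + N * volume ((L ∩ D) \ E) := mul_add _ _ _
    _ ≤ volume E + volume E := add_le_add b1 b2
    _ = 2 * volume E := (two_mul _).symm

theorem ergodic_add_coe_of_irrational {α : ℝ} (hα : Irrational α) :
    Ergodic (fun s : UnitAddCircle => s + (α : UnitAddCircle)) := by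
  refine AddCircle.ergodic_add_right.2 (addOrderOf_eq_zero_iff'.2 fun n hn h => ?_)
  rw [← AddCircle.coe_nsmul, AddCircle.coe_eq_zero_iff] at h
  obtain ⟨m, hm⟩ := h
  refine (irrational_iff_ne_rational α).1 hα m n (by exact_mod_cast hn.ne') ?_
  have : (n : ℝ) ≠ 0 := by exact_mod_cast hn.ne'
  rw [zsmul_eq_mul, mul_one, nsmul_eq_mul] at hm
  field_simp
  rw [hm]; push_cast; ring

instance : DiscreteMeasurableSpace ℤˣ :=
  ⟨fun S => ⟨Units.val '' S, trivial, Set.preimage_image_eq _ Units.val_injective⟩⟩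

instance : SFinite uniformZ2 := by unfold uniformZ2; infer_instance

theorem ae_uniformZ2_iff {p : ℤˣ → Prop} : (∀ᵐ κ ∂uniformZ2, p κ) ↔ p 1 ∧ p (-1) := by
  rw [uniformZ2, Measure.ae_ennreal_smul_measure_eq (by simp), ae_iff, Measure.count_eq_zero_iff,
    Set.eq_empty_iff_forall_notMem]
  simp only [Set.mem_ofPred_eq, not_not]
  refine ⟨fun h => ⟨h _, h _⟩, fun h κ => ?_⟩
  rcases Int.units_eq_one_or κ with rfl | rfl
  exacts [h.1, h.2]

theorem measurePreserving_skewProd (α : ℝ) {φ : UnitAddCircle → ℤˣ} (hφ : Measurable φ) :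
    MeasurePreserving (skewProd α φ) prodMeas prodMeas := by
  refine (measurePreserving_add_right volume (α : UnitAddCircle)).skew_product
    (g := fun s κ => κ * φ s) ?_ (ae_of_all _ fun s => ?_)
  · exact Measurable.mul (M := ℤˣ) measurable_snd (hφ.comp measurable_fst)
  · refine Measure.ext fun S _ => ?_
    rw [Measure.map_apply (measurable_of_countable _) (.of_discrete), uniformZ2, Measure.smul_apply,
      Measure.smul_apply]
    congr 1
    have hpre : (fun κ : ℤˣ => κ * φ s) ⁻¹' S = (fun κ : ℤˣ => κ * (φ s)⁻¹) '' S := by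
      ext κ; simp
    rw [hpre, Measure.count_injective_image]
    exact mul_left_injective _

theorem measurable_phiT (t : ℝ) : Measurable (phiT t) := by
  have : Measurable fun s : UnitAddCircle =>
      ((AddCircle.equivIco 1 0 s : Set.Ico (0 : ℝ) (0 + 1)) : ℝ) :=
    measurable_subtype_coe.comp (AddCircle.measurableEquivIco 1 0).measurable
  exact Measurable.ite (this measurableSet_Iio) measurable_const measurable_const

theorem measurable_phi4 (t t' u : ℝ) : Measurable (phi4 t t' u) :=
  Measurable.mul (M := ℤˣ) (measurable_phiT t)
    ((measurable_phiT t').comp (measurable_add_const (u : UnitAddCircle)))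

/-- A cocycle whose skew product is not ergodic is a coboundary: it is the coboundary of the
`{−1,1}`-valued function that is `1` exactly on `B`. -/
theorem exists_transfer_of_not_ergodic {α : ℝ} (hα : Irrational α) {φ : UnitAddCircle → ℤˣ}
    (hφ : Measurable φ) (hne : ¬Ergodic (skewProd α φ) prodMeas) :
    ∃ B C : Set UnitAddCircle, MeasurableSet B ∧ MeasurableSet C ∧ volume Cᶜ = 0 ∧
      ∀ s ∈ C, s + (α : UnitAddCircle) ∈ C ∧
        (s + (α : UnitAddCircle) ∈ B ↔ (s ∈ B ↔ φ s = 1)) := by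
  by_contra hcon
  refine hne ⟨measurePreserving_skewProd α hφ, ⟨fun A hA hinv => ?_⟩⟩
  by_contra hconst
  have hmem : ∀ s κ, (s + (α : UnitAddCircle), κ * φ s) ∈ A ↔ (s, κ) ∈ A := fun s κ => by
    conv_rhs => rw [← hinv]
    rfl
  set P : Set UnitAddCircle := {s | (s, (1 : ℤˣ)) ∈ A}
  set M : Set UnitAddCircle := {s | (s, (-1 : ℤˣ)) ∈ A}
  have hP : MeasurableSet P := hA.preimage (by fun_prop)
  have hM : MeasurableSet M := hA.preimage (by fun_prop)
  have hPM : ∀ s, (φ s = 1 ∧ (s + (α : UnitAddCircle) ∈ P ↔ s ∈ P) ∧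
      (s + (α : UnitAddCircle) ∈ M ↔ s ∈ M)) ∨
      (φ s = -1 ∧ (s + (α : UnitAddCircle) ∈ P ↔ s ∈ M) ∧
      (s + (α : UnitAddCircle) ∈ M ↔ s ∈ P)) := by
    intro s
    have h1 := hmem s 1
    have h2 := hmem s (-1)
    rcases Int.units_eq_one_or (φ s) with e | e
    · left; simp only [e, mul_one] at h1 h2; exact ⟨e, h1, h2⟩
    · right
      simp only [e, mul_neg, mul_one, neg_neg] at h1 h2
      exact ⟨e, h2, h1⟩
  have hrot := ergodic_add_coe_of_irrational hα
  have hI := hrot.toPreErgodic.aeconst_set (hP.inter hM) (by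
    ext s
    have := hPM s
    simp only [Set.mem_preimage, Set.mem_inter_iff]
    tauto)
  have hU := hrot.toPreErgodic.aeconst_set (hP.union hM) (by
    ext s
    have := hPM s
    simp only [Set.mem_preimage, Set.mem_union]
    tauto)
  rw [eventuallyConst_set] at hI hU hconst
  have hIe : ∀ᵐ s, s ∉ P ∩ M := by
    refine hI.resolve_left fun h => hconst (Or.inl ?_)
    rw [prodMeas, Measure.ae_prod_mem_iff_ae_ae_mem hA]
    filter_upwards [h] with s hs
    exact ae_uniformZ2_iff.2 hs
  have hUe : ∀ᵐ s, s ∈ P ∪ M := by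
    refine hU.resolve_right fun h => hconst (Or.inr ?_)
    have := Measure.ae_prod_mem_iff_ae_ae_mem (μ := (volume : Measure UnitAddCircle))
      (ν := uniformZ2) hA.compl
    rw [prodMeas]
    refine this.2 ?_
    filter_upwards [h] with s hs
    exact ae_uniformZ2_iff.2 (not_or.1 hs)
  refine hcon ⟨P, (P ∪ M) \ (P ∩ M), hP, (hP.union hM).diff (hP.inter hM), ?_, ?_⟩
  · refine mem_ae_iff.1 ?_
    filter_upwards [hIe, hUe] with s h1 h2 using ⟨h2, h1⟩
  · intro s hs
    have h1 : (-1 : ℤˣ) ≠ 1 := by decide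
    simp only [Set.mem_sdiff, Set.mem_inter_iff, Set.mem_union] at hs ⊢
    rcases hPM s with ⟨e, k1, k2⟩ | ⟨e, k1, k2⟩ <;> 
      by_cases hsP : s ∈ P <;> by_cases hsM : s ∈ M <;> simp_all

theorem tendsto_measure_translate_ne {B : Set UnitAddCircle} (hB : MeasurableSet B) :
    Tendsto (fun h : ℝ => volume {s : UnitAddCircle | ¬(s + (h : UnitAddCircle) ∈ B ↔ s ∈ B)})
      (𝓝 0) (𝓝 0) := by
  let f : ℝ → C(UnitAddCircle, UnitAddCircle) := fun h => ⟨fun s => s + h, by fun_prop⟩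
  have hf : Continuous f := ContinuousMap.continuous_of_continuous_uncurry _ (by
    have := AddCircle.continuous_mk' (1 : ℝ)
    change Continuous fun p : ℝ × UnitAddCircle => p.2 + (p.1 : UnitAddCircle)
    exact continuous_snd.add (this.comp continuous_fst))
  have hmp : ∀ h, MeasurePreserving (f h) volume volume := fun h =>
    measurePreserving_add_right volume _
  have key := tendsto_measure_symmDiff_preimage_nhds_zero (μ := volume) (ν := volume)
    (hf.tendsto 0) (Eventually.of_forall hmp) (hmp 0) hB.nullMeasurableSet (measure_ne_top _ _)
  refine key.congr fun h => congrArg _ ?_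
  ext s
  have : f 0 s = s := by simp [f]
  simp only [Set.mem_symmDiff, Set.mem_preimage, this, Set.mem_ofPred_eq]
  change (s + (h : UnitAddCircle) ∈ B ∧ _ ∨ _) ↔ _
  tauto

/-- If the four-jump cocycle `φ^u_{t,t'}` over the rotation by an
irrational `α` is not ergodic, then `min{‖q_k(t−t')‖, ‖q_k(t+t')‖} → 0`. -/
theorem stmt16 (α : ℝ) (hα : Irrational α)
    (t t' u : ℝ) (ht : t ∈ Set.Ico (0 : ℝ) 1) (ht' : t' ∈ Set.Ico (0 : ℝ) 1)
    (hu : u ∈ Set.Ico (0 : ℝ) 1)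
    (hne : ¬ Ergodic (skewProd α (phi4 t t' u)) prodMeas) :
    Tendsto (fun k : ℕ =>
      min (distInt (cfDen α k * (t - t'))) (distInt (cfDen α k * (t + t'))))
      atTop (𝓝 0) := by
  obtain ⟨B, C, hB, hC, hC0, hBC⟩ :=
    exists_transfer_of_not_ergodic hα (measurable_phi4 t t' u) hne
  have hq := tendsto_cfDen_atTop hα
  have hnonneg : ∀ k, 0 ≤
      min (distInt (cfDen α k * (t - t'))) (distInt (cfDen α k * (t + t'))) := fun k =>
    le_min (abs_nonneg _) (abs_nonneg _)
  refine Metric.tendsto_atTop'.2 fun ε' hε' => ?_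
  obtain ⟨ε, hε0, hε4, hεε'⟩ : ∃ ε : ℝ, 0 < ε ∧ ε ≤ 1 / 4 ∧ 8 * ε < ε' :=
    ⟨min (1 / 4) (ε' / 16), by positivity, min_le_left _ _, by
      have := min_le_right (1 / 4) (ε' / 16); linarith⟩
  have hhq : Tendsto (fun k => ε / cfDen α k) atTop (𝓝 0) := hq.const_div_atTop ε
  have hsmall := ((tendsto_measure_translate_ne hB).comp hhq).eventually
    (gt_mem_nhds (show (0 : ENNReal) < ENNReal.ofReal (ε ^ 2 / 16) by simp; positivity))
  obtain ⟨K, hK⟩ := eventually_atTop.1 (hsmall.and (hq.eventually_ge_atTop (2 / ε)))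
  refine ⟨K, fun k hk => ?_⟩
  obtain ⟨hvol, hlarge⟩ := hK k hk.le
  obtain ⟨q, p, hqk, hq0, hcop, happ⟩ := cfDen_eq_natCast hα k
  rw [Real.dist_eq, sub_zero, abs_of_nonneg (hnonneg k)]
  simp only [Function.comp_apply] at hvol
  rw [hqk] at hvol hlarge ⊢
  have hqR : (0 : ℝ) < q := by exact_mod_cast hq0
  set h := ε / q with hh
  have h0 : 0 < h := by positivity
  have hεq : 2 ≤ ε * q := by rwa [div_le_iff₀' hε0] at hlarge
  have hhq' : h * q = ε := div_mul_cancel₀ _ hqR.ne'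
  have hq1 : (1 : ℝ) ≤ q := by exact_mod_cast hq0
  have h1 : h < 1 := by nlinarith
  set N := ⌊ε * q⌋₊ with hN
  have hN1 : (N : ℝ) ≤ ε * q := Nat.floor_le (by positivity)
  have hN2 : ε * q < N + 1 := Nat.lt_floor_add_one _
  set X : Fin 4 → UnitAddCircle := ![0, (t : UnitAddCircle), -u, t' - u] with hX
  have hret : ∀ m : ℕ, 0 < m → m ≤ 2 * N → h ≤ ‖m • (α : UnitAddCircle)‖ := by
    intro m hm hmN
    have hmR : (m : ℝ) ≤ 2 * (ε * q) := by
      have : (m : ℝ) ≤ 2 * N := by exact_mod_cast hmN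
      linarith
    have hmq : m < q := by
      have : (m : ℝ) < q := by nlinarith
      exact_mod_cast this
    refine le_trans ?_ (le_norm_nsmul_of_coprime hcop happ hm hmq)
    rw [hh, div_le_iff₀ hqR]
    have : (1 / (q : ℝ) - m / (q : ℝ) ^ 2) * q = 1 - m / q := by field_simp
    rw [this, le_sub_comm, div_le_iff₀ hqR]
    nlinarith
  have hclose : ∀ i, ∃ j, j ≠ i ∧ ∃ m : ℤ, |m| ≤ N ∧ ‖X j - X i - m • (α : UnitAddCircle)‖ < h := by
    intro i
    by_contra! hno
    have hmul := mul_le_measure_of_isolated_jump h0 h1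
      (phi4_add_mul_phi4 (u := u) ht ht' h0 h1) hB hC hC0 hBC hno hret
    have hlt : (2 : ENNReal) * ENNReal.ofReal (ε ^ 2 / 16) = ENNReal.ofReal (ε ^ 2 / 8) := by
      rw [show (2 : ENNReal) = ENNReal.ofReal 2 by simp, ← ENNReal.ofReal_mul (by norm_num)]
      congr 1; ring
    have hmul' : (N : ENNReal) * ENNReal.ofReal (h / 2) ≤ ENNReal.ofReal (ε ^ 2 / 8) :=
      hmul.trans (hlt ▸ mul_le_mul_right hvol.le 2)
    rw [← ENNReal.ofReal_natCast, ← ENNReal.ofReal_mul (Nat.cast_nonneg _),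
      ENNReal.ofReal_le_ofReal_iff (by positivity)] at hmul'
    have hNh : ε * q / 2 * h ≤ N * h := by gcongr; linarith
    have : ε * q / 2 * h = ε ^ 2 / 2 := by rw [← hhq']; ring
    nlinarith [sq_pos_of_pos hε0]
  have hfinal := min_norm_le_of_forall_exists_close (q • (t : UnitAddCircle)) (q • (t' : UnitAddCircle))
    (q • (u : UnitAddCircle)) (δ := 2 * ε) (fun i => q • X i)
    (by
      funext i
      fin_cases i <;> simp [hX, nsmul_sub])
    (fun i => by
      obtain ⟨j, hj, m, hm, hlt⟩ := hclose i
      refine ⟨j, hj, ?_⟩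
      have e : q • X j - q • X i =
          q • (X j - X i - m • (α : UnitAddCircle)) + m • q • (α : UnitAddCircle) := by
        rw [nsmul_sub, nsmul_sub, smul_comm m q]; abel
      have hmR : |(m : ℝ)| ≤ N := by exact_mod_cast hm
      have b1 : ‖q • (X j - X i - m • (α : UnitAddCircle))‖ ≤ q * h :=
        norm_nsmul_le.trans (by gcongr)
      have b2 : ‖m • q • (α : UnitAddCircle)‖ ≤ ε * q * (1 / q) := by
        refine (norm_zsmul_le m _).trans ?_
        rw [Int.norm_eq_abs]
        exact mul_le_mul (hmR.trans hN1) (norm_nsmul_le_of_abs_sub_le happ) (norm_nonneg _)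
          (by positivity)
      have b3 : ε * q * (1 / q) = ε := by field_simp
      rw [e]
      refine (norm_add_le _ _).trans ?_
      linarith)
  have hdist : ∀ x : ℝ, distInt (q * x) = ‖q • (x : UnitAddCircle)‖ := fun x => by
    rw [← AddCircle.coe_nsmul, UnitAddCircle.norm_eq, nsmul_eq_mul, distInt]
  rw [hdist, hdist, AddCircle.coe_sub, AddCircle.coe_add, nsmul_sub, nsmul_add]
  linarith
end
end

section
/- Let α be irrational. The set E of pairs (t,t') ∈ S¹ × S¹ such that for every u ∈ S¹ the four-jump cocycle φ^u_{t,t'} is ergodic has full product Lebesgue measure in S¹ × S¹. -/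
open MeasureTheory Filter Topology

noncomputable section

instance discreteMeasurableSpace_intUnits : DiscreteMeasurableSpace ℤˣ := by
  have h1 : MeasurableSet ({1} : Set ℤˣ) := by
    refine ⟨{1}, measurableSet_singleton _, ?_⟩
    ext x
    simp
  have : MeasurableSingletonClass ℤˣ := ⟨fun x => by
    rcases Int.units_eq_one_or x with rfl | rfl
    · exact h1
    · convert! h1.compl using 1
      ext y
      rcases Int.units_eq_one_or y with rfl | rfl <;> simp⟩
  infer_instance

instance inst_s17 : SFinite uniformZ2 := by
  unfold uniformZ2
  infer_instance

theorem map_mul_left_uniformZ2 (c : ℤˣ) : uniformZ2.map (fun κ => κ * c) = uniformZ2 := by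
  unfold uniformZ2
  rw [Measure.map_smul]
  congr 1
  refine Measure.ext_of_singleton fun x => ?_
  rw [Measure.map_apply (by fun_prop) (measurableSet_singleton x)]
  have : (fun κ : ℤˣ => κ * c) ⁻¹' {x} = {x * c⁻¹} := by
    ext y
    simp
  rw [this, Measure.count_singleton, Measure.count_singleton]

theorem measurable_uncurry_of_units {φ : UnitAddCircle → ℤˣ} (hφ : Measurable φ) :
    Measurable (Function.uncurry fun (s : UnitAddCircle) (κ : ℤˣ) => κ * φ s) := by
  have h : Measurable (fun p : ℤˣ × ℤˣ => p.1 * p.2) := Measurable.of_discrete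
  exact h.comp (measurable_snd.prodMk (hφ.comp measurable_fst))

theorem addOrderOf_coe_of_irrational {α : ℝ} (hα : Irrational α) :
    addOrderOf (α : UnitAddCircle) = 0 := by
  rw [addOrderOf_eq_zero_iff, isOfFinAddOrder_iff_nsmul_eq_zero]
  rintro ⟨n, hn, h⟩
  rw [← AddCircle.coe_nsmul, AddCircle.coe_eq_zero_iff] at h
  obtain ⟨m, hm⟩ := h
  refine (hα.natCast_mul hn.ne') ⟨m, ?_⟩
  simpa using hm

/-- The Birkhoff product `φ(s) φ(s+α) ⋯ φ(s+(q-1)α)`. -/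
def birkhoffProd (α : ℝ) (φ : UnitAddCircle → ℤˣ) (q : ℕ) (s : UnitAddCircle) : ℤˣ :=
  ∏ j ∈ Finset.range q, φ (s + j • (α : UnitAddCircle))

theorem measurable_birkhoffProd (α : ℝ) {φ : UnitAddCircle → ℤˣ} (hφ : Measurable φ) (q : ℕ) :
    Measurable (birkhoffProd α φ q) := by
  have : MeasurableMul₂ ℤˣ := ⟨Measurable.of_discrete⟩
  unfold birkhoffProd
  exact Finset.measurable_fun_prod _ fun j _ => hφ.comp (measurable_add_const _)

theorem iterate_skewProd (α : ℝ) (φ : UnitAddCircle → ℤˣ) (q : ℕ) (p : UnitAddCircle × ℤˣ) :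
    (skewProd α φ)^[q] p = (p.1 + q • (α : UnitAddCircle), p.2 * birkhoffProd α φ q p.1) := by
  induction q with
  | zero => simp [birkhoffProd]
  | succ q ih =>
    rw [Function.iterate_succ_apply', ih]
    simp only [skewProd, birkhoffProd, Finset.prod_range_succ, succ_nsmul]
    rw [mul_assoc, add_assoc]

theorem tendsto_measure_symmDiff_translate {A : Set UnitAddCircle} (hA : MeasurableSet A) :
    Tendsto (fun x : UnitAddCircle => volume (symmDiff ((fun s => s + x) ⁻¹' A) A)) (𝓝 0) (𝓝 0) := by
  let F : UnitAddCircle → C(UnitAddCircle, UnitAddCircle) :=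
    fun x => ⟨fun s => s + x, by fun_prop⟩
  have hF : Continuous F := ContinuousMap.continuous_of_continuous_uncurry _ (by
    simp only [Function.uncurry_def, F]
    exact continuous_snd.add continuous_fst)
  have := tendsto_measure_symmDiff_preimage_nhds_zero (μ := volume) (ν := volume)
    (hF.tendsto 0) (Eventually.of_forall fun x => measurePreserving_add_right volume x)
    (measurePreserving_add_right volume 0) hA.nullMeasurableSet (measure_ne_top _ _)
  simpa [F] using this

theorem ae_prodMeas_of_forall {E : Set (UnitAddCircle × ℤˣ)} (hE : MeasurableSet E)
    (h : ∀ᵐ s : UnitAddCircle, (s, (1 : ℤˣ)) ∈ E ∧ (s, (-1 : ℤˣ)) ∈ E) :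
    ∀ᵐ p ∂prodMeas, p ∈ E := by
  rw [prodMeas, Measure.ae_prod_mem_iff_ae_ae_mem hE]
  filter_upwards [h] with s hs
  refine Eventually.of_forall fun κ => ?_
  rcases Int.units_eq_one_or κ with rfl | rfl
  exacts [hs.1, hs.2]

/-- If the Birkhoff products along a sequence of near-periods of the rotation take the value `-1`
on sets of measure bounded below, then the skew product is ergodic. -/
theorem ergodic_skewProd {α : ℝ} (hα : Irrational α) {φ : UnitAddCircle → ℤˣ} (hφ : Measurable φ)
    {c : ENNReal} (hc : c ≠ 0)
    (h : ∀ ε > 0, ∃ q : ℕ, ‖q • (α : UnitAddCircle)‖ < ε ∧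
      c ≤ volume {s | birkhoffProd α φ q s = -1}) :
    Ergodic (skewProd α φ) prodMeas := by
  refine ⟨measurePreserving_skewProd α hφ, ⟨fun E hE hinv => ?_⟩⟩
  have hrot : Ergodic (fun s : UnitAddCircle => s + (α : UnitAddCircle)) volume :=
    AddCircle.ergodic_add_right.2 (addOrderOf_coe_of_irrational hα)
  have hT (p) : (p.1 + (α : UnitAddCircle), p.2 * φ p.1) ∈ E ↔ p ∈ E := by
    conv_rhs => rw [← hinv]
    rfl
  have hP : MeasurableSet {s : UnitAddCircle | (s, (1 : ℤˣ)) ∈ E} :=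
    measurable_id.prodMk measurable_const hE
  have hN : MeasurableSet {s : UnitAddCircle | (s, (-1 : ℤˣ)) ∈ E} :=
    measurable_id.prodMk measurable_const hE
  have hinter := hrot.aeconst_set (hP.inter hN) (by
    ext s
    have h1 := hT (s, 1)
    have h2 := hT (s, -1)
    rcases Int.units_eq_one_or (φ s) with h | h <;> (simp_all; try tauto))
  have hunion := hrot.aeconst_set (hP.union hN) (by
    ext s
    have h1 := hT (s, 1)
    have h2 := hT (s, -1)
    rcases Int.units_eq_one_or (φ s) with h | h <;> (simp_all; try tauto))
  rw [eventuallyConst_set] at hinter hunion ⊢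
  rcases hinter with hi | hi
  · exact Or.inl (ae_prodMeas_of_forall hE hi)
  rcases hunion with hu | hu
  swap
  · refine Or.inr (ae_prodMeas_of_forall (E := Eᶜ) hE.compl ?_)
    filter_upwards [hu] with s hs
    exact not_or.1 hs
  exfalso
  have hlt := (tendsto_measure_symmDiff_translate hP).eventually (gt_mem_nhds (pos_iff_ne_zero.2 hc))
  obtain ⟨ε, hε, hball⟩ := Metric.eventually_nhds_iff.1 hlt
  obtain ⟨q, hq, hcq⟩ := h ε hε
  refine absurd (hball (y := q • (α : UnitAddCircle)) (by simpa using hq)) (not_lt.2 (hcq.trans ?_))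
  refine measure_mono_ae ?_
  have hmp := measurePreserving_add_right (volume : Measure UnitAddCircle) (q • (α : UnitAddCircle))
  filter_upwards [hi, hu, hmp.quasiMeasurePreserving.ae hi, hmp.quasiMeasurePreserving.ae hu]
    with s h1 h2 h3 h4 hs
  have hTq (p) : (p.1 + q • (α : UnitAddCircle), p.2 * birkhoffProd α φ q p.1) ∈ E ↔ p ∈ E := by
    rw [← iterate_skewProd]
    have : ((skewProd α φ)^[q]) ⁻¹' E = E := by
      rw [Set.preimage_iterate_eq]
      exact Function.iterate_fixed hinv q
    exact Set.ext_iff.1 this p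
  have h5 := hTq (s, 1)
  have hs' : birkhoffProd α φ q s = -1 := hs
  simp only [hs', one_mul] at h5
  refine Set.mem_symmDiff.2 ?_
  simp only [Set.mem_preimage, Set.mem_ofPred_eq, Set.mem_inter_iff,
    Set.mem_union] at *
  tauto

theorem phiT_coe_s17 {t : ℝ} (h0 : 0 ≤ t) (h1 : t ≤ 1) (y : ℝ) :
    phiT t (y : UnitAddCircle) = (⌊y⌋ - ⌊y - t⌋).negOnePow := by
  unfold phiT
  rw [AddCircle.coe_equivIco_mk_apply]
  simp only [div_one, mul_one]
  have hf0 := Int.fract_nonneg y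
  have hf1 := Int.fract_lt_one y
  have hy := Int.floor_add_fract y
  split_ifs with h
  · have : ⌊y - t⌋ = ⌊y⌋ - 1 := by
      rw [Int.floor_eq_iff]
      push_cast
      constructor <;> linarith
    simp [this]
  · have : ⌊y - t⌋ = ⌊y⌋ := by
      rw [Int.floor_eq_iff]
      constructor <;> linarith
    simp [this]

/-- The function equal to `-1` on the arc `[-h, 0)` and `1` elsewhere. -/
def jump (h : ℝ) (s : UnitAddCircle) : ℤˣ := -phiT (1 - h) s

theorem phiT_mul_phiT_add {t h : ℝ} (ht0 : 0 ≤ t) (ht1 : t ≤ 1) (h0 : 0 ≤ h) (h1 : h ≤ 1)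
    (s : UnitAddCircle) :
    phiT t s * phiT t (s + (h : UnitAddCircle)) = jump h s * jump h (s - (t : UnitAddCircle)) := by
  induction s using QuotientAddGroup.induction_on with
  | H y =>
    have e1 : ((y : ℝ) : UnitAddCircle) + (h : UnitAddCircle) = ((y + h : ℝ) : UnitAddCircle) := rfl
    have e2 : ((y : ℝ) : UnitAddCircle) - (t : UnitAddCircle) = ((y - t : ℝ) : UnitAddCircle) := rfl
    have j (x : ℝ) : jump h (x : UnitAddCircle) = (⌊x + h⌋ - ⌊x⌋).negOnePow := by
      rw [jump, phiT_coe_s17 (by linarith) (by linarith), ← Int.negOnePow_succ,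
        show x - (1 - h) = x + h - 1 by ring, Int.floor_sub_one, Int.negOnePow_eq_iff]
      exact ⟨⌊x⌋ - ⌊x + h⌋ + 1, by ring⟩
    change phiT t (y : UnitAddCircle) * phiT t ((y : UnitAddCircle) + (h : UnitAddCircle)) =
      jump h (y : UnitAddCircle) * jump h ((y : UnitAddCircle) - (t : UnitAddCircle))
    rw [e1, e2, j, j, phiT_coe_s17 ht0 ht1, phiT_coe_s17 ht0 ht1, ← Int.negOnePow_add, ← Int.negOnePow_add,
      Int.negOnePow_eq_iff, show y + h - t = y - t + h by ring]
    exact ⟨⌊y⌋ - ⌊y - t + h⌋, by ring⟩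

theorem jump_eq_neg_one {h : ℝ} (h1 : h ≤ 1) {s : UnitAddCircle}
    (hs : ‖s + ((h / 2 : ℝ) : UnitAddCircle)‖ < h / 2) : jump h s = -1 := by
  obtain ⟨r, hr, rfl⟩ : ∃ r ∈ Set.Ico (0 : ℝ) (0 + 1), (r : UnitAddCircle) = s :=
    ⟨_, (AddCircle.equivIco 1 0 s).2, (AddCircle.equivIco 1 0).symm_apply_apply s⟩
  rw [zero_add] at hr
  rw [← AddCircle.coe_add, UnitAddCircle.norm_eq, abs_lt] at hs
  obtain ⟨hs1, hs2⟩ := hs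
  set n := round (r + h / 2)
  have hn1 : (0 : ℝ) < n := by linarith [hr.1]
  have hn2 : (n : ℝ) < 2 := by linarith [hr.2]
  have hn : n = 1 := by
    have := Int.cast_pos.1 hn1
    have : n < 2 := by exact_mod_cast hn2
    omega
  have hf : Int.fract r = r := Int.fract_eq_self.2 hr
  rw [hn] at hs1
  rw [jump, phiT, AddCircle.coe_equivIco_mk_apply, if_neg]
  simp only [div_one, mul_one, hf, not_lt]
  push_cast at hs1
  linarith

theorem norm_le_of_jump_ne_one {h : ℝ} {s : UnitAddCircle} (hs : jump h s ≠ 1) :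
    ‖s + ((h / 2 : ℝ) : UnitAddCircle)‖ ≤ h / 2 := by
  obtain ⟨r, hr, rfl⟩ : ∃ r ∈ Set.Ico (0 : ℝ) (0 + 1), (r : UnitAddCircle) = s :=
    ⟨_, (AddCircle.equivIco 1 0 s).2, (AddCircle.equivIco 1 0).symm_apply_apply s⟩
  rw [zero_add] at hr
  have hf : Int.fract r = r := Int.fract_eq_self.2 hr
  have hle : 1 - h ≤ r := by
    by_contra hlt
    refine hs ?_
    rw [jump, phiT, AddCircle.coe_equivIco_mk_apply, if_pos, neg_neg]
    rw [div_one, mul_one, hf]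
    exact not_le.1 hlt
  have e : (r : UnitAddCircle) + ((h / 2 : ℝ) : UnitAddCircle) =
      ((r - 1 + h / 2 : ℝ) : UnitAddCircle) := by
    rw [AddCircle.coe_add, AddCircle.coe_sub, AddCircle.coe_period, sub_zero]
  rw [e]
  refine (QuotientAddGroup.norm_mk_le_norm).trans ?_
  rw [Real.norm_eq_abs, abs_le]
  constructor <;> linarith [hr.2]

theorem jump_eq_one_of_separated {h : ℝ} {θ x a b : UnitAddCircle} {j k : ℕ}
    (hx : ‖x + j • θ + a + ((h / 2 : ℝ) : UnitAddCircle)‖ < h / 2)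
    (hsep : h ≤ ‖a - b + ((j : ℤ) - k) • θ‖) : jump h (x + k • θ + b) = 1 := by
  by_contra hne
  have h2 := norm_le_of_jump_ne_one hne
  have e : a - b + ((j : ℤ) - k) • θ = (x + j • θ + a + ((h / 2 : ℝ) : UnitAddCircle)) -
      (x + k • θ + b + ((h / 2 : ℝ) : UnitAddCircle)) := by
    rw [sub_smul, natCast_zsmul, natCast_zsmul]
    abel
  rw [e] at hsep
  have := norm_sub_le (x + j • θ + a + ((h / 2 : ℝ) : UnitAddCircle))
    (x + k • θ + b + ((h / 2 : ℝ) : UnitAddCircle))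
  linarith

theorem norm_sub_zsmul_ge {h : ℝ} {θ : UnitAddCircle} {q : ℕ}
    (hq : ∀ j : ℕ, 0 < j → j < q → h ≤ ‖j • θ‖) {j k : ℕ} (hj : j < q) (hk : k < q)
    (hjk : j ≠ k) : h ≤ ‖((j : ℤ) - k) • θ‖ := by
  rcases lt_or_gt_of_ne hjk with hlt | hlt
  · have := hq (k - j) (by omega) (by omega)
    rwa [← natCast_zsmul, ← norm_neg, ← neg_smul, Nat.cast_sub hlt.le, neg_sub] at this
  · have := hq (j - k) (by omega) (by omega)
    rwa [← natCast_zsmul, Nat.cast_sub hlt.le] at this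

theorem prod_jump_eq_neg_one {h : ℝ} (h1 : h ≤ 1) {θ : UnitAddCircle} {q : ℕ}
    (hq : ∀ j : ℕ, 0 < j → j < q → h ≤ ‖j • θ‖) {a b c d : UnitAddCircle}
    (hb : ∀ m : ℤ, |m| < q → h ≤ ‖a - b + m • θ‖)
    (hc : ∀ m : ℤ, |m| < q → h ≤ ‖a - c + m • θ‖)
    (hd : ∀ m : ℤ, |m| < q → h ≤ ‖a - d + m • θ‖)
    {x : UnitAddCircle} {j : ℕ} (hj : j < q)
    (hx : ‖x + j • θ + a + ((h / 2 : ℝ) : UnitAddCircle)‖ < h / 2) :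
    ∏ k ∈ Finset.range q, (jump h (x + k • θ + a) * jump h (x + k • θ + b) *
      jump h (x + k • θ + c) * jump h (x + k • θ + d)) = -1 := by
  have hm (k : ℕ) (hk : k < q) : |(j : ℤ) - k| < q := by
    rw [abs_lt]
    omega
  rw [Finset.prod_eq_single j]
  · rw [jump_eq_neg_one h1 hx, jump_eq_one_of_separated hx (hb _ (hm j hj)),
      jump_eq_one_of_separated hx (hc _ (hm j hj)), jump_eq_one_of_separated hx (hd _ (hm j hj))]
    simp
  · intro k hk hkj
    have hk := Finset.mem_range.1 hk
    rw [jump_eq_one_of_separated hx (hb _ (hm k hk)),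
      jump_eq_one_of_separated hx (hc _ (hm k hk)), jump_eq_one_of_separated hx (hd _ (hm k hk)),
      jump_eq_one_of_separated hx (b := a)]
    · simp
    · simpa using norm_sub_zsmul_ge hq hj hk hkj.symm
  · simp [hj]

theorem phi4_mul_phi4_add {t t' h : ℝ} (ht : t ∈ Set.Ico (0 : ℝ) 1) (ht' : t' ∈ Set.Ico (0 : ℝ) 1)
    (h0 : 0 ≤ h) (h1 : h ≤ 1) (u : ℝ) (s : UnitAddCircle) :
    phi4 t t' u s * phi4 t t' u (s + (h : UnitAddCircle)) =
      jump h (s + 0) * jump h (s + -(t : UnitAddCircle)) * jump h (s + (u : UnitAddCircle)) *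
        jump h (s + ((u : UnitAddCircle) - t')) := by
  have e1 := phiT_mul_phiT_add ht.1 ht.2.le h0 h1 s
  have e2 := phiT_mul_phiT_add ht'.1 ht'.2.le h0 h1 (s + u)
  rw [add_zero, ← sub_eq_add_neg, ← add_sub_assoc, mul_assoc, ← e2, ← e1, phi4, phi4,
    add_right_comm s (h : UnitAddCircle)]
  exact mul_mul_mul_comm _ _ _ _

/-- `t`, `t - t'` and `t + t'` stay at distance at least `r` from the points `mθ`, `|m| < 2q`. -/
def Separated (θ : UnitAddCircle) (q : ℕ) (r : ℝ) (t t' : UnitAddCircle) : Prop :=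
  ∀ m : ℤ, |m| < 2 * q →
    r ≤ ‖t + m • θ‖ ∧ r ≤ ‖t - t' + m • θ‖ ∧ r ≤ ‖t + t' + m • θ‖

theorem Separated.isolated {θ t t' : UnitAddCircle} {q : ℕ} {h : ℝ} (h0 : 0 ≤ h)
    (hS : Separated θ q (2 * h) t t') (u : UnitAddCircle) :
    (∀ m : ℤ, |m| < q → h ≤ ‖0 - -t + m • θ‖ ∧ h ≤ ‖0 - u + m • θ‖ ∧ h ≤ ‖0 - (u - t') + m • θ‖) ∨
    (∀ m : ℤ, |m| < q →
      h ≤ ‖-t - 0 + m • θ‖ ∧ h ≤ ‖-t - u + m • θ‖ ∧ h ≤ ‖-t - (u - t') + m • θ‖) := by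
  by_contra! hcon
  obtain ⟨⟨m, hm, H1⟩, ⟨n, hn, H2⟩⟩ := hcon
  rw [abs_lt] at hm hn
  have hS' (k : ℤ) (hk : -(2 * q : ℤ) < k) (hk' : k < 2 * q) := hS k (abs_lt.2 ⟨hk, hk'⟩)
  have key (a b c : UnitAddCircle) (hc : c = a - b) (ha : ‖a‖ < h) (hb : ‖b‖ < h)
      (h2 : 2 * h ≤ ‖c‖) : False := by
    have := norm_sub_le a b
    rw [← hc] at this
    linarith
  have ht1 : h ≤ ‖0 - -t + m • θ‖ := by
    have := (hS' m (by omega) (by omega)).1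
    rw [zero_sub, neg_neg]
    linarith
  have ht2 : h ≤ ‖-t - 0 + n • θ‖ := by
    have := (hS' (-n) (by omega) (by omega)).1
    rw [← norm_neg, neg_add, neg_sub, zero_sub, neg_neg, ← neg_smul]
    linarith
  have H1' : ‖0 - u + m • θ‖ < h ∨ ‖0 - (u - t') + m • θ‖ < h := by
    by_contra! hh
    exact absurd (H1 ht1 hh.1) (not_lt.2 hh.2)
  have H2' : ‖-t - u + n • θ‖ < h ∨ ‖-t - (u - t') + n • θ‖ < h := by
    by_contra! hh
    exact absurd (H2 ht2 hh.1) (not_lt.2 hh.2)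
  have hmn := hS' (m - n) (by omega) (by omega)
  rw [sub_smul] at hmn
  rcases H1' with h1 | h1 <;> rcases H2' with h2 | h2
  · exact key _ _ _ (by abel) h1 h2 hmn.1
  · exact key _ _ _ (by abel) h1 h2 hmn.2.1
  · exact key _ _ _ (by abel) h1 h2 hmn.2.2
  · exact key _ _ _ (by abel) h1 h2 hmn.1

theorem volume_iUnion_ball {h : ℝ} (h1 : h ≤ 1) {θ : UnitAddCircle} {q : ℕ}
    (hq : ∀ j : ℕ, 0 < j → j < q → h ≤ ‖j • θ‖) (a : UnitAddCircle) :
    volume (⋃ j ∈ Finset.range q, {x : UnitAddCircle | ‖x + j • θ + a‖ < h / 2}) =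
      q * ENNReal.ofReal h := by
  have hball (j : ℕ) : {x : UnitAddCircle | ‖x + j • θ + a‖ < h / 2} =
      Metric.ball (-(j • θ + a)) (h / 2) := by
    ext x
    rw [mem_ball_iff_norm, sub_neg_eq_add, ← add_assoc]
    rfl
  rw [measure_biUnion_finset]
  · have hv (j : ℕ) : volume {x : UnitAddCircle | ‖x + j • θ + a‖ < h / 2} = ENNReal.ofReal h := by
      rw [hball, ← measure_congr AddCircle.closedBall_ae_eq_ball, AddCircle.volume_closedBall,
        mul_div_cancel₀ _ two_ne_zero, min_eq_right h1]
    simp [hv]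
  · intro j hj k hk hjk
    rw [Function.onFun, Set.disjoint_left]
    intro x hx hy
    simp only [Set.mem_ofPred_eq] at hx hy
    have hsep := norm_sub_zsmul_ge hq (by simpa using hj) (by simpa using hk) hjk
    have e : ((j : ℤ) - k) • θ = (x + j • θ + a) - (x + k • θ + a) := by
      rw [sub_smul, natCast_zsmul, natCast_zsmul]
      abel
    rw [e] at hsep
    have := norm_sub_le (x + j • θ + a) (x + k • θ + a)
    linarith
  · intro j _
    rw [hball]
    exact Metric.isOpen_ball.measurableSet

theorem le_volume_birkhoffProd_phi4 {α t t' h : ℝ} (ht : t ∈ Set.Ico (0 : ℝ) 1)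
    (ht' : t' ∈ Set.Ico (0 : ℝ) 1) (h0 : 0 ≤ h) (h1 : h ≤ 1) {q : ℕ}
    (hq : ∀ j : ℕ, 0 < j → j < q → h ≤ ‖j • (α : UnitAddCircle)‖)
    (hS : Separated (α : UnitAddCircle) q (2 * h) t t') (u : ℝ) :
    q * ENNReal.ofReal h ≤ 2 * volume {s | birkhoffProd α (phi4 t t' u) q s = -1} := by
  set S := {s | birkhoffProd α (phi4 t t' u) q s = -1} with hSdef
  have hSm : MeasurableSet S :=
    measurable_birkhoffProd α (measurable_phi4 t t' u) q (measurableSet_singleton _)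
  set τ : UnitAddCircle → UnitAddCircle := fun s => s + (h : UnitAddCircle)
  have hcover (x) (hx : birkhoffProd α (phi4 t t' u) q x * birkhoffProd α (phi4 t t' u) q (τ x) = -1) :
      x ∈ S ∪ τ ⁻¹' S := by
    rcases Int.units_eq_one_or (birkhoffProd α (phi4 t t' u) q x) with hx1 | hx1
    · right
      rw [hx1, one_mul] at hx
      exact hx
    · exact Or.inl hx1
  have hprod (x) : birkhoffProd α (phi4 t t' u) q x * birkhoffProd α (phi4 t t' u) q (τ x) =
      ∏ k ∈ Finset.range q, (jump h (x + k • (α : UnitAddCircle) + 0) *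
        jump h (x + k • (α : UnitAddCircle) + -(t : UnitAddCircle)) *
        jump h (x + k • (α : UnitAddCircle) + (u : UnitAddCircle)) *
        jump h (x + k • (α : UnitAddCircle) + ((u : UnitAddCircle) - t'))) := by
    rw [birkhoffProd, birkhoffProd, ← Finset.prod_mul_distrib]
    refine Finset.prod_congr rfl fun k _ => ?_
    rw [← phi4_mul_phi4_add ht ht' h0 h1, add_right_comm x (h : UnitAddCircle)]
  have hsub : ∃ a : UnitAddCircle, (⋃ j ∈ Finset.range q,
      {x : UnitAddCircle | ‖x + j • (α : UnitAddCircle) + a‖ < h / 2}) ⊆ S ∪ τ ⁻¹' S := by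
    rcases hS.isolated h0 u with hI | hI
    · refine ⟨0 + ((h / 2 : ℝ) : UnitAddCircle), Set.iUnion₂_subset fun j hj x hx => hcover x ?_⟩
      rw [hprod]
      refine prod_jump_eq_neg_one h1 hq (fun m hm => (hI m hm).1) (fun m hm => (hI m hm).2.1)
        (fun m hm => (hI m hm).2.2) (Finset.mem_range.1 hj) ?_
      rw [add_assoc _ (0 : UnitAddCircle)]
      exact hx
    · refine ⟨-t + ((h / 2 : ℝ) : UnitAddCircle), Set.iUnion₂_subset fun j hj x hx => hcover x ?_⟩
      rw [hprod]
      refine Eq.trans (Finset.prod_congr rfl fun k _ => ?_)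
        (prod_jump_eq_neg_one h1 hq (fun m hm => (hI m hm).1) (fun m hm => (hI m hm).2.1)
          (fun m hm => (hI m hm).2.2) (Finset.mem_range.1 hj) (x := x) ?_)
      · rw [mul_comm (jump h _) (jump h _)]
      · rw [add_assoc _ (-t : UnitAddCircle)]
        exact hx
  obtain ⟨a, ha⟩ := hsub
  calc q * ENNReal.ofReal h = _ := (volume_iUnion_ball h1 hq a).symm
    _ ≤ volume (S ∪ τ ⁻¹' S) := measure_mono ha
    _ ≤ volume S + volume (τ ⁻¹' S) := measure_union_le _ _
    _ = 2 * volume S := by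
      rw [(measurePreserving_add_right volume (h : UnitAddCircle)).measure_preimage
        hSm.nullMeasurableSet, two_mul]

theorem exists_nsmul_norm_lt_and_separated (α : ℝ) {ε : ℝ} (hε : 0 < ε) :
    ∃ q : ℕ, 0 < q ∧ ‖q • (α : UnitAddCircle)‖ < ε ∧
      ∀ j : ℕ, 0 < j → j < q → 1 / (2 * q : ℝ) ≤ ‖j • (α : UnitAddCircle)‖ := by
  classical
  have hex : ∃ q : ℕ, 0 < q ∧ ‖q • (α : UnitAddCircle)‖ < ε := by
    obtain ⟨n, hn⟩ := exists_nat_one_div_lt hε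
    obtain ⟨j, hj, hle⟩ := AddCircle.exists_norm_nsmul_le (α : UnitAddCircle) (Nat.succ_pos n)
    refine ⟨j, hj.1, hle.trans_lt (lt_of_le_of_lt ?_ hn)⟩
    gcongr
    simp
  refine ⟨Nat.find hex, (Nat.find_spec hex).1, (Nat.find_spec hex).2, fun j hj hjq => ?_⟩
  obtain ⟨hq0, hqε⟩ := Nat.find_spec hex
  have hjε : ε ≤ ‖j • (α : UnitAddCircle)‖ := by
    have := Nat.find_min hex hjq
    push Not at this
    exact this hj
  set q := Nat.find hex
  have hqj := hqε.trans_le hjε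
  have hj' : (0 : ℝ) < j := by exact_mod_cast hj
  have hjq' : (j : ℝ) < q := by exact_mod_cast hjq
  rw [← AddCircle.coe_nsmul, ← AddCircle.coe_nsmul, UnitAddCircle.norm_eq, UnitAddCircle.norm_eq,
    nsmul_eq_mul, nsmul_eq_mul] at hqj
  rw [← AddCircle.coe_nsmul, UnitAddCircle.norm_eq, nsmul_eq_mul]
  set a := round ((j : ℝ) * α)
  set b := round ((q : ℝ) * α)
  have hqpos : (0 : ℝ) < q := hj'.trans hjq'
  have hident : (q : ℝ) * (j * α - a) - j * (q * α - b) = ((b * j - a * q : ℤ) : ℝ) := by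
    push_cast
    ring
  by_cases hz : b * j - a * q = 0
  · rw [hz, Int.cast_zero, sub_eq_zero] at hident
    have := congrArg abs hident
    rw [abs_mul, abs_mul, abs_of_pos hqpos, abs_of_pos hj'] at this
    nlinarith [abs_nonneg ((q : ℝ) * α - b)]
  · have h1 : (1 : ℝ) ≤ |((b * j - a * q : ℤ) : ℝ)| := by
      exact_mod_cast Int.one_le_abs hz
    rw [← hident] at h1
    have h2 := abs_sub ((q : ℝ) * (j * α - a)) (j * (q * α - b))
    rw [abs_mul, abs_mul, abs_of_pos hqpos, abs_of_pos hj'] at h2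
    rw [div_le_iff₀ (by positivity)]
    nlinarith [abs_nonneg ((j : ℝ) * α - a)]

theorem volume_norm_add_lt_le {c : UnitAddCircle → UnitAddCircle} (hc : Measurable c) (r : ℝ) :
    volume {p : UnitAddCircle × UnitAddCircle | ‖p.1 + c p.2‖ < r} ≤ ENNReal.ofReal (2 * r) := by
  have hm : MeasurableSet {p : UnitAddCircle × UnitAddCircle | ‖p.1 + c p.2‖ < r} :=
    measurableSet_lt (measurable_fst.add (hc.comp measurable_snd)).norm measurable_const
  rw [Measure.volume_eq_prod, Measure.prod_apply_symm hm]
  refine (lintegral_mono (g := fun _ => ENNReal.ofReal (2 * r)) fun y => ?_).trans (by simp)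
  have : (fun x => (x, y)) ⁻¹' {p : UnitAddCircle × UnitAddCircle | ‖p.1 + c p.2‖ < r} ⊆
      Metric.closedBall (-(c y)) r := by
    intro x hx
    rw [mem_closedBall_iff_norm, sub_neg_eq_add]
    exact le_of_lt hx
  refine (measure_mono this).trans ?_
  rw [AddCircle.volume_closedBall]
  exact ENNReal.ofReal_le_ofReal (min_le_right _ _)

theorem volume_not_separated_le (θ : UnitAddCircle) (q : ℕ) (r : ℝ) :
    volume {p : UnitAddCircle × UnitAddCircle | ¬Separated θ q r p.1 p.2} ≤
      ENNReal.ofReal (24 * (q * r)) := by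
  have hsub : {p : UnitAddCircle × UnitAddCircle | ¬Separated θ q r p.1 p.2} ⊆
      ⋃ m ∈ Finset.Ioo (-(2 * q : ℤ)) (2 * q),
        ({p : UnitAddCircle × UnitAddCircle | ‖p.1 + m • θ‖ < r} ∪
          {p : UnitAddCircle × UnitAddCircle | ‖p.1 + (-p.2 + m • θ)‖ < r} ∪
          {p : UnitAddCircle × UnitAddCircle | ‖p.1 + (p.2 + m • θ)‖ < r}) := by
    intro p hp
    change ¬Separated θ q r p.1 p.2 at hp
    unfold Separated at hp
    push Not at hp
    obtain ⟨m, hm, H⟩ := hp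
    refine Set.mem_iUnion₂.2 ⟨m, Finset.mem_Ioo.2 (abs_lt.1 hm), ?_⟩
    simp only [Set.mem_union, Set.mem_ofPred_eq, ← add_assoc, ← sub_eq_add_neg]
    by_contra! hh
    exact absurd (H hh.1.1 hh.1.2) (not_lt.2 hh.2)
  refine (measure_mono hsub).trans ((measure_biUnion_finset_le _ _).trans ?_)
  have hterm (m : ℤ) : volume
      ({p : UnitAddCircle × UnitAddCircle | ‖p.1 + m • θ‖ < r} ∪
        {p : UnitAddCircle × UnitAddCircle | ‖p.1 + (-p.2 + m • θ)‖ < r} ∪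
        {p : UnitAddCircle × UnitAddCircle | ‖p.1 + (p.2 + m • θ)‖ < r}) ≤
      3 * ENNReal.ofReal (2 * r) := by
    have e : (3 : ENNReal) * ENNReal.ofReal (2 * r) =
      ENNReal.ofReal (2 * r) + ENNReal.ofReal (2 * r) + ENNReal.ofReal (2 * r) := by ring
    rw [e]
    refine (measure_union_le _ _).trans (add_le_add ((measure_union_le _ _).trans (add_le_add ?_ ?_)) ?_)
    · exact volume_norm_add_lt_le (c := fun _ => m • θ) measurable_const r
    · exact volume_norm_add_lt_le (c := fun y => -y + m • θ) (by fun_prop) r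
    · exact volume_norm_add_lt_le (c := fun y => y + m • θ) (by fun_prop) r
  refine (Finset.sum_le_sum fun m _ => hterm m).trans ?_
  rw [Finset.sum_const, nsmul_eq_mul]
  have hcard : ((Finset.Ioo (-(2 * q : ℤ)) (2 * q)).card : ENNReal) ≤ 4 * q := by
    rw [Int.card_Ioo]
    exact_mod_cast (by omega : (2 * (q : ℤ) - -(2 * q : ℤ) - 1).toNat ≤ 4 * q)
  refine (mul_le_mul_left hcard _).trans (le_of_eq ?_)
  rw [show 24 * (q * r) = ((4 * q : ℕ) : ℝ) * ((3 : ℕ) * (2 * r)) by push_cast; ring,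
    ENNReal.ofReal_mul (Nat.cast_nonneg _), ENNReal.ofReal_mul (Nat.cast_nonneg _),
    ENNReal.ofReal_natCast, ENNReal.ofReal_natCast]
  push_cast
  rfl

theorem measure_eventually_mem_le {X : Type*} [MeasurableSpace X] {μ : Measure X} {B : ℕ → Set X}
    {C : ENNReal} (hB : ∀ n, μ (B n) ≤ C) : μ {x | ∀ᶠ n in atTop, x ∈ B n} ≤ C := by
  have e : {x | ∀ᶠ n in atTop, x ∈ B n} = ⋃ N, ⋂ n ≥ N, B n := by
    ext x
    simp [eventually_atTop]
  have hmono : Monotone fun N : ℕ => ⋂ n ≥ N, B n := fun N M hNM =>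
    Set.biInter_subset_biInter_left fun n (hn : M ≤ n) => hNM.trans hn
  rw [e, hmono.measure_iUnion]
  exact iSup_le fun N => (measure_mono (Set.iInter₂_subset N le_rfl)).trans (hB N)

theorem ae_frequently_separated (θ : UnitAddCircle) {q : ℕ → ℕ} (hq : ∀ n, 0 < q n) :
    ∀ᵐ p : UnitAddCircle × UnitAddCircle, ∃ k : ℕ, ∃ᶠ n in atTop,
      Separated θ (q n) (2 * (1 / (2 * (k + 1)) / q n)) p.1 p.2 := by
  rw [ae_iff]
  have hle (k : ℕ) : volume {p : UnitAddCircle × UnitAddCircle | ¬∃ k : ℕ, ∃ᶠ n in atTop,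
      Separated θ (q n) (2 * (1 / (2 * (k + 1)) / q n)) p.1 p.2} ≤
      ENNReal.ofReal (24 * (1 / ((k : ℝ) + 1))) := by
    refine le_trans (measure_mono fun p hp => ?_)
      (measure_eventually_mem_le (B := fun n => {p : UnitAddCircle × UnitAddCircle |
        ¬Separated θ (q n) (2 * (1 / (2 * (k + 1)) / q n)) p.1 p.2}) fun n => ?_)
    · exact not_frequently.1 (not_exists.1 hp k)
    · refine (volume_not_separated_le θ (q n) _).trans (le_of_eq ?_)
      have : (q n : ℝ) ≠ 0 := by exact_mod_cast (hq n).ne'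
      congr 1
      field_simp
  have hlim : Tendsto (fun k : ℕ => ENNReal.ofReal (24 * (1 / ((k : ℝ) + 1)))) atTop (𝓝 0) := by
    have := ENNReal.tendsto_ofReal (tendsto_one_div_add_atTop_nhds_zero_nat.const_mul (24 : ℝ))
    simpa using this
  exact le_antisymm (ge_of_tendsto' hlim hle) zero_le

theorem ae_restrict_Ico_prod_of_ae {P : UnitAddCircle × UnitAddCircle → Prop}
    (hP : ∀ᵐ p, P p) :
    ∀ᵐ p : ℝ × ℝ, p ∈ Set.Ico (0 : ℝ) 1 ×ˢ Set.Ico (0 : ℝ) 1 →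
      P ((p.1 : UnitAddCircle), (p.2 : UnitAddCircle)) := by
  have hmk := UnitAddCircle.measurePreserving_mk 0
  rw [zero_add, ← Measure.restrict_congr_set Ico_ae_eq_Ioc] at hmk
  have := (hmk.prod hmk).quasiMeasurePreserving.ae hP
  rw [Measure.prod_restrict, ae_restrict_iff' (measurableSet_Ico.prod measurableSet_Ico)] at this
  exact this

theorem ergodic_skewProd_phi4 {α : ℝ} (hα : Irrational α) {q : ℕ → ℕ} (hq0 : ∀ n, 0 < q n)
    (hq : Tendsto (fun n => ‖q n • (α : UnitAddCircle)‖) atTop (𝓝 0))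
    (hsep : ∀ n, ∀ j : ℕ, 0 < j → j < q n → 1 / (2 * q n : ℝ) ≤ ‖j • (α : UnitAddCircle)‖)
    {t t' : ℝ} (ht : t ∈ Set.Ico (0 : ℝ) 1) (ht' : t' ∈ Set.Ico (0 : ℝ) 1) {k : ℕ}
    (hS : ∃ᶠ n in atTop, Separated (α : UnitAddCircle) (q n) (2 * (1 / (2 * (k + 1)) / q n)) t t')
    (u : ℝ) : Ergodic (skewProd α (phi4 t t' u)) prodMeas := by
  have hδ : (0 : ℝ) < 1 / (2 * (k + 1)) := by positivity
  have hδ' : (1 : ℝ) / (2 * (k + 1)) ≤ 1 / 2 := by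
    gcongr
    linarith [(Nat.cast_nonneg k : (0 : ℝ) ≤ k)]
  set δ : ℝ := 1 / (2 * (k + 1))
  refine ergodic_skewProd hα (measurable_phi4 t t' u) (c := ENNReal.ofReal δ / 2)
    (by simpa using hδ) fun ε hε => ?_
  obtain ⟨n, hn, hnε⟩ := (hS.and_eventually (hq.eventually (gt_mem_nhds hε))).exists
  have hqn : (1 : ℝ) ≤ q n := by exact_mod_cast hq0 n
  have hle : δ / q n ≤ 1 / (2 * q n) := by
    rw [← div_div]
    gcongr
  refine ⟨q n, hnε, ENNReal.div_le_of_le_mul' ?_⟩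
  refine le_trans (le_of_eq ?_) (le_volume_birkhoffProd_phi4 ht ht' (h := δ / q n) (by positivity)
    ((div_le_self hδ.le hqn).trans (by linarith)) (fun j hj hjq => hle.trans (hsep n j hj hjq)) hn u)
  rw [← ENNReal.ofReal_natCast, ← ENNReal.ofReal_mul (Nat.cast_nonneg _),
    mul_div_cancel₀ _ (by positivity)]

/-- For irrational `α`, the set of pairs `(t,t') ∈ S¹ × S¹` (identified
with `[0,1) × [0,1)`) such that the four-jump cocycle `φ^u_{t,t'}` is ergodic for every
`u ∈ S¹` has full product Lebesgue measure. -/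
theorem stmt17 (α : ℝ) (hα : Irrational α) :
    volume {p : ℝ × ℝ | p.1 ∈ Set.Ico (0 : ℝ) 1 ∧ p.2 ∈ Set.Ico (0 : ℝ) 1 ∧
      ∀ u ∈ Set.Ico (0 : ℝ) 1, Ergodic (skewProd α (phi4 p.1 p.2 u)) prodMeas} = 1 := by
  choose q hq0 hqε hsep using fun n : ℕ =>
    exists_nsmul_norm_lt_and_separated α (Nat.one_div_pos_of_nat (α := ℝ) (n := n))
  have hq : Tendsto (fun n => ‖q n • (α : UnitAddCircle)‖) atTop (𝓝 0) :=
    squeeze_zero (fun _ => norm_nonneg _) (fun n => (hqε n).le)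
      tendsto_one_div_add_atTop_nhds_zero_nat
  have hae := ae_restrict_Ico_prod_of_ae (ae_frequently_separated (α : UnitAddCircle) hq0)
  have hvol : volume (Set.Ico (0 : ℝ) 1 ×ˢ Set.Ico (0 : ℝ) 1) = 1 := by
    simp [Measure.volume_eq_prod, Measure.prod_prod]
  rw [← hvol]
  refine le_antisymm (measure_mono fun p hp => ⟨hp.1, hp.2.1⟩) (measure_mono_ae ?_)
  filter_upwards [hae] with p hp hmem
  obtain ⟨k, hk⟩ := hp hmem
  exact ⟨hmem.1, hmem.2, fun u _ => ergodic_skewProd_phi4 hα hq0 hq hsep hmem.1 hmem.2 hk u⟩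
end
end

section
/- Let T(t,s) = (t, s+t) (mod 1) on the two-dimensional torus S¹ × S¹, preserving the product Lebesgue (Haar) measure μ = dt × ds. Then μ is disjoint, in the sense of Furstenberg, from every ergodic measure-preserving system: for every measure-preserving system (Y, S, ν) with ν an ergodic S-invariant probability measure, every joining of μ and ν — i.e., every (T×S)-invariant probability measure ξ on (S¹×S¹) × Y whose marginals are μ and ν — equals the product measure μ × ν. -/
open MeasureTheory Filter Topology

noncomputable section

/-- The transformation `T(t,s) = (t, s+t)` on the two-dimensional torus. -/
def torusT : UnitAddCircle × UnitAddCircle → UnitAddCircle × UnitAddCircle :=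
  fun p => (p.1, p.2 + p.1)

/-- In an inner product space, a sequence of pairwise orthogonal vectors of norm at most one
cannot have a constant nonzero inner product with a fixed vector. -/
lemma eq_zero_of_forall_inner_eq {E : Type*} [NormedAddCommGroup E] [InnerProductSpace ℂ E]
    {w : E} {u : ℕ → E} {a : ℂ} (hu : ∀ k, ‖u k‖ ≤ 1)
    (horth : ∀ k l, k ≠ l → inner ℂ (u k) (u l) = 0) (ha : ∀ k, inner ℂ w (u k) = a) :
    a = 0 := by
  have key (N : ℕ) : N * ‖a‖ ^ 2 ≤ ‖w‖ ^ 2 := by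
    rcases N.eq_zero_or_pos with rfl | hN
    · simp
    have hsq : ‖∑ k ∈ Finset.range N, u k‖ ^ 2 ≤ N := by
      have h : (inner ℂ (∑ k ∈ Finset.range N, u k) (∑ k ∈ Finset.range N, u k) : ℂ)
          = ((∑ k ∈ Finset.range N, ‖u k‖ ^ 2 : ℝ) : ℂ) := by
        rw [sum_inner]
        push_cast
        refine Finset.sum_congr rfl fun k hk => ?_
        rw [inner_sum, Finset.sum_eq_single_of_mem k hk fun l _ hl => horth k l hl.symm,
          inner_self_eq_norm_sq_to_K]
        rfl
      rw [inner_self_eq_norm_sq_to_K] at h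
      have h' : ‖∑ k ∈ Finset.range N, u k‖ ^ 2 = ∑ k ∈ Finset.range N, ‖u k‖ ^ 2 := by
        exact Complex.ofReal_injective (by simpa using h)
      rw [h']
      calc ∑ k ∈ Finset.range N, ‖u k‖ ^ 2 ≤ ∑ k ∈ Finset.range N, (1 : ℝ) :=
            Finset.sum_le_sum fun k _ => pow_le_one₀ (norm_nonneg _) (hu k)
        _ = N := by simp
    have hin : (inner ℂ w (∑ k ∈ Finset.range N, u k) : ℂ) = N * a := by
      simp [ha]
    have hle : N * ‖a‖ ≤ ‖w‖ * ‖∑ k ∈ Finset.range N, u k‖ := by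
      have := norm_inner_le_norm (𝕜 := ℂ) w (∑ k ∈ Finset.range N, u k)
      simpa [hin] using this
    have hN' : (0 : ℝ) < N := by exact_mod_cast hN
    have h2 : (N * ‖a‖) ^ 2 ≤ ‖w‖ ^ 2 * N := by
      calc (N * ‖a‖) ^ 2 ≤ (‖w‖ * ‖∑ k ∈ Finset.range N, u k‖) ^ 2 := by gcongr
        _ = ‖w‖ ^ 2 * ‖∑ k ∈ Finset.range N, u k‖ ^ 2 := by ring
        _ ≤ ‖w‖ ^ 2 * N := by gcongr
    refine le_of_mul_le_mul_right ?_ hN'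
    linarith [h2, mul_pow (N : ℝ) ‖a‖ 2, sq (N : ℝ)]
  by_contra hne
  have hpos : 0 < ‖a‖ ^ 2 := by positivity
  obtain ⟨N, hN⟩ := exists_nat_gt (‖w‖ ^ 2 / ‖a‖ ^ 2)
  rw [div_lt_iff₀ hpos] at hN
  exact absurd (key N) (not_le.2 hN)

/-- Pairwise orthogonal functions bounded by one with a common integral have integral zero. -/
lemma eq_zero_of_forall_integral_eq {Ω : Type*} [MeasurableSpace Ω] {ρ : Measure Ω}
    [IsProbabilityMeasure ρ] {W : ℕ → Ω → ℂ} {a : ℂ} (hm : ∀ k, Measurable (W k))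
    (hb : ∀ k p, ‖W k p‖ ≤ 1)
    (horth : ∀ k l, k ≠ l → ∫ p, W l p * (starRingEnd ℂ) (W k p) ∂ρ = 0)
    (ha : ∀ k, ∫ p, W k p ∂ρ = a) : a = 0 := by
  have hL (k : ℕ) : MemLp (W k) 2 ρ :=
    MemLp.of_bound (hm k).aestronglyMeasurable 1 (ae_of_all _ (hb k))
  have h1 : MemLp (fun _ : Ω => (1 : ℂ)) 2 ρ := memLp_const 1
  refine eq_zero_of_forall_inner_eq (w := h1.toLp) (u := fun k => (hL k).toLp)
    (fun k => ?_) (fun k l hkl => ?_) fun k => ?_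
  · refine (Lp.norm_le_of_ae_bound zero_le_one (C := 1) ?_).trans ?_
    · filter_upwards [(hL k).coeFn_toLp] with p hp
      rw [hp]
      exact hb k p
    · simp [measureUnivNNReal]
  · rw [L2.inner_def, ← horth k l hkl]
    refine integral_congr_ae ?_
    filter_upwards [(hL k).coeFn_toLp, (hL l).coeFn_toLp] with p hk hl
    rw [hk, hl]
    rfl
  · rw [L2.inner_def, ← ha k]
    refine integral_congr_ae ?_
    filter_upwards [(hL k).coeFn_toLp, h1.coeFn_toLp] with p hk hp
    rw [hk, hp]
    simp

/-- Identity transformations are disjoint from ergodic ones. -/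
lemma eq_prod_of_measurePreserving_map_id {X Y : Type*} [MeasurableSpace X] [MeasurableSpace Y]
    {S : Y → Y} {ν : Measure Y} [IsProbabilityMeasure ν] (hS : Ergodic S ν)
    {ξ : Measure (X × Y)} [IsFiniteMeasure ξ] (hinv : MeasurePreserving (Prod.map id S) ξ ξ)
    (hsnd : ξ.snd = ν) : ξ = ξ.fst.prod ν := by
  refine (Measure.prod_eq fun A B hA hB => ?_).symm
  let κ : Measure Y := (ξ.restrict (Prod.fst ⁻¹' A)).snd
  have hκ {C : Set Y} (hC : MeasurableSet C) : κ C = ξ (A ×ˢ C) := by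
    rw [Measure.snd_apply hC, Measure.restrict_apply (measurable_snd hC), Set.inter_comm]
    rfl
  have hκS : MeasurePreserving S κ κ := by
    refine ⟨hS.measurable, Measure.ext fun C hC => ?_⟩
    rw [Measure.map_apply hS.measurable hC, hκ (hS.measurable hC), hκ hC,
      ← hinv.measure_preimage (hA.prod hC).nullMeasurableSet]
    rfl
  have hac : κ ≪ ν := by
    refine Measure.AbsolutelyContinuous.mk fun C hC h0 => ?_
    rw [hκ hC]
    rw [← hsnd, Measure.snd_apply hC] at h0
    exact measure_mono_null (fun p hp => hp.2) h0
  obtain ⟨c, hc⟩ := hS.eq_smul_of_absolutelyContinuous hκS hac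
  have hcA : ξ.fst A = c := by
    have := hκ MeasurableSet.univ
    rw [hc] at this
    rw [Measure.fst_apply hA, ← Set.prod_univ, ← this]
    simp
  rw [← hκ hB, hc, hcA]
  rfl

instance isProbabilityMeasure_volume_unitAddCircle :
    IsProbabilityMeasure (volume : Measure UnitAddCircle) :=
  ⟨UnitAddCircle.measure_univ⟩

lemma integral_fourier_eq_zero {n : ℤ} (hn : n ≠ 0) :
    ∫ t : UnitAddCircle, fourier n t = 0 :=
  integral_eq_zero_of_add_right_eq_neg (fourier_add_half_inv_index hn one_pos)

/-- Two continuous linear functionals on `C(UnitAddCircle, ℂ)` given by weighted integrals agree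
if they agree on all Fourier monomials. -/
lemma integral_comp_mul_eq_of_forall_fourier {Ω : Type*} [MeasurableSpace Ω] {P Q : Measure Ω}
    [IsFiniteMeasure P] [IsFiniteMeasure Q] {b : Ω → UnitAddCircle} (hb : Measurable b)
    {c : Ω → ℂ} (hc : Measurable c) {K : ℝ} (hK : ∀ p, ‖c p‖ ≤ K)
    (h : ∀ n : ℤ, ∫ p, fourier n (b p) * c p ∂P = ∫ p, fourier n (b p) * c p ∂Q)
    (f : C(UnitAddCircle, ℂ)) : ∫ p, f (b p) * c p ∂P = ∫ p, f (b p) * c p ∂Q := by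
  have hint (ρ : Measure Ω) [IsFiniteMeasure ρ] (f : C(UnitAddCircle, ℂ)) :
      Integrable (fun p => f (b p) * c p) ρ := by
    refine Integrable.of_bound (C := ‖f‖ * K)
      ((f.continuous.measurable.comp hb).mul hc).aestronglyMeasurable (ae_of_all _ fun p => ?_)
    rw [norm_mul]
    exact mul_le_mul (f.norm_coe_le_norm _) (hK p) (norm_nonneg _) (norm_nonneg _)
  let L (ρ : Measure Ω) [IsFiniteMeasure ρ] : C(UnitAddCircle, ℂ) →L[ℂ] ℂ :=
    LinearMap.mkContinuous
      { toFun := fun f => ∫ p, f (b p) * c p ∂ρ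
        map_add' := fun f g => by
          simp only [ContinuousMap.add_apply, add_mul]
          exact integral_add (hint ρ f) (hint ρ g)
        map_smul' := fun r f => by
          simp only [ContinuousMap.smul_apply, smul_eq_mul, mul_assoc, RingHom.id_apply]
          exact integral_const_mul _ _ }
      (K * ρ.real Set.univ) fun f => by
        refine (norm_integral_le_of_norm_le_const (C := ‖f‖ * K) (ae_of_all _ fun p => ?_)).trans
          (le_of_eq (by ring))
        rw [norm_mul]
        exact mul_le_mul (f.norm_coe_le_norm _) (hK p) (norm_nonneg _) (norm_nonneg _)
  have hL : L P = L Q := by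
    refine ContinuousLinearMap.ext_on
      (Submodule.dense_iff_topologicalClosure_eq_top.2 span_fourier_closure_eq_top) ?_
    rintro _ ⟨n, rfl⟩
    exact h n
  exact DFunLike.congr_fun hL f

/-- A finite measure on the two-dimensional torus is determined by its Fourier coefficients. -/
lemma ext_of_forall_integral_fourier_mul_fourier {P Q : Measure (UnitAddCircle × UnitAddCircle)}
    [IsFiniteMeasure P] [IsFiniteMeasure Q]
    (h : ∀ m n : ℤ, ∫ p, fourier m p.1 * fourier n p.2 ∂P
      = ∫ p, fourier m p.1 * fourier n p.2 ∂Q) : P = Q := by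
  have h1 (f : C(UnitAddCircle, ℂ)) (n : ℤ) :
      ∫ p, f p.1 * fourier n p.2 ∂P = ∫ p, f p.1 * fourier n p.2 ∂Q :=
    integral_comp_mul_eq_of_forall_fourier measurable_fst
      ((fourier n).continuous.measurable.comp measurable_snd)
      (fun p => (fourier n).norm_coe_le_norm p.2) (h · n) f
  have h2 (f g : C(UnitAddCircle, ℂ)) :
      ∫ p, g p.2 * f p.1 ∂P = ∫ p, g p.2 * f p.1 ∂Q :=
    integral_comp_mul_eq_of_forall_fourier measurable_snd
      (f.continuous.measurable.comp measurable_fst)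
      (fun p => f.norm_coe_le_norm p.1) (fun n => by simpa only [Function.comp_apply, mul_comm] using h1 f n) g
  refine Measure.ext_of_integral_mul_boundedContinuousFunction fun f g => ?_
  have h3 := h2 ⟨fun t => (f t : ℂ), by fun_prop⟩ ⟨fun t => (g t : ℂ), by fun_prop⟩
  simp only [ContinuousMap.coe_mk, ← Complex.ofReal_mul, integral_complex_ofReal] at h3
  simpa only [mul_comm] using Complex.ofReal_injective h3

section Joining

variable {Y : Type*} [MeasurableSpace Y] {S : Y → Y} {ν : Measure Y}
  {ξ : Measure ((UnitAddCircle × UnitAddCircle) × Y)}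

/-- The first coordinate of the torus is independent of the ergodic factor. -/
lemma map_fst_fst_snd_eq_prod [IsProbabilityMeasure ν] (hS : Ergodic S ν) [IsProbabilityMeasure ξ]
    (hξinv : MeasurePreserving (fun p => (torusT p.1, S p.2)) ξ ξ)
    (hfst : ξ.map Prod.fst = (volume : Measure (UnitAddCircle × UnitAddCircle)))
    (hsnd : ξ.map Prod.snd = ν) :
    ξ.map (fun p => (p.1.1, p.2)) = (volume : Measure UnitAddCircle).prod ν := by
  have hπ : Measurable fun p : (UnitAddCircle × UnitAddCircle) × Y => (p.1.1, p.2) := by fun_prop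
  have : IsProbabilityMeasure (ξ.map fun p => (p.1.1, p.2)) :=
    Measure.isProbabilityMeasure_map hπ.aemeasurable
  have hid : MeasurePreserving (Prod.map id S) (ξ.map fun p => (p.1.1, p.2))
      (ξ.map fun p => (p.1.1, p.2)) := by
    refine ⟨measurable_id.prodMap hS.measurable, ?_⟩
    rw [Measure.map_map (measurable_id.prodMap hS.measurable) hπ]
    conv_rhs => rw [← hξinv.map_eq, Measure.map_map hπ hξinv.measurable]
    rfl
  rw [eq_prod_of_measurePreserving_map_id hS hid]
  · congr 1
    rw [Measure.fst, Measure.map_map measurable_fst hπ]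
    have : (Prod.fst ∘ fun p : (UnitAddCircle × UnitAddCircle) × Y => (p.1.1, p.2))
        = Prod.fst ∘ Prod.fst := rfl
    rw [this, ← Measure.map_map measurable_fst measurable_fst, hfst, Measure.volume_eq_prod,
      ← Measure.fst, Measure.fst_prod]
  · rw [Measure.snd, Measure.map_map measurable_snd hπ]
    exact hsnd

lemma integral_fourier_mul_eq [IsProbabilityMeasure ν] [IsProbabilityMeasure ξ]
    (hind : ξ.map (fun p => (p.1.1, p.2)) = (volume : Measure UnitAddCircle).prod ν)
    (m : ℤ) {g : Y → ℂ} (hg : Measurable g) :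
    ∫ p, fourier m p.1.1 * g p.2 ∂ξ = (∫ t : UnitAddCircle, fourier m t) * ∫ y, g y ∂ν := by
  have hπ : Measurable fun p : (UnitAddCircle × UnitAddCircle) × Y => (p.1.1, p.2) := by fun_prop
  rw [← integral_prod_mul, ← hind, integral_map hπ.aemeasurable]
  exact (((fourier m).continuous.measurable.comp measurable_fst).mul
    (hg.comp measurable_snd)).aestronglyMeasurable

/-- The skew Fourier modes of the torus are uncorrelated with the ergodic factor. -/
lemma integral_fourier_mul_fourier_mul_eq_zero [IsProbabilityMeasure ν] (hS : Measurable S)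
    [IsProbabilityMeasure ξ]
    (hξinv : MeasurePreserving (fun p => (torusT p.1, S p.2)) ξ ξ)
    (hind : ξ.map (fun p => (p.1.1, p.2)) = (volume : Measure UnitAddCircle).prod ν)
    (m : ℤ) {n : ℤ} (hn : n ≠ 0) {g : Y → ℂ} (hg : Measurable g) (hg1 : ∀ y, ‖g y‖ ≤ 1) :
    ∫ p, fourier m p.1.1 * fourier n p.1.2 * g p.2 ∂ξ = 0 := by
  let W (k : ℕ) (p : (UnitAddCircle × UnitAddCircle) × Y) : ℂ :=
    fourier (m + k * n) p.1.1 * fourier n p.1.2 * g (S^[k] p.2)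
  have hgk (k : ℕ) : Measurable fun y => g (S^[k] y) := hg.comp (hS.iterate k)
  have hW (k : ℕ) : Measurable (W k) :=
    (((fourier _).continuous.measurable.comp (measurable_fst.comp measurable_fst)).mul
      ((fourier n).continuous.measurable.comp (measurable_snd.comp measurable_fst))).mul
      ((hgk k).comp measurable_snd)
  have hnorm (j : ℤ) (t : UnitAddCircle) : ‖(fourier j t : ℂ)‖ = 1 := by
    rw [fourier_apply]
    exact Circle.norm_coe _
  refine eq_zero_of_forall_integral_eq (ρ := ξ) hW (fun k p => ?_) (fun k l hkl => ?_) fun k => ?_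
  · simp only [W, norm_mul, hnorm, one_mul]
    exact hg1 _
  · have hkey (p : (UnitAddCircle × UnitAddCircle) × Y) : W l p * (starRingEnd ℂ) (W k p)
        = fourier ((l - k : ℤ) * n) p.1.1
          * (g (S^[l] p.2) * (starRingEnd ℂ) (g (S^[k] p.2))) := by
      have h1 : (fourier n p.1.2 : ℂ) * (starRingEnd ℂ) (fourier n p.1.2) = 1 := by
        rw [Complex.mul_conj', hnorm]
        simp
      have h2 : ((l - k : ℤ) * n) = (m + l * n) + -(m + k * n) := by ring
      rw [h2, fourier_add, fourier_neg]
      simp only [W, map_mul]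
      linear_combination (fourier (m + l * n) p.1.1 * g (S^[l] p.2)
        * (starRingEnd ℂ) (fourier (m + k * n) p.1.1) * (starRingEnd ℂ) (g (S^[k] p.2))) * h1
    have hlk : ((l - k : ℤ) * n) ≠ 0 :=
      mul_ne_zero (sub_ne_zero.2 (by exact_mod_cast hkl.symm)) hn
    simp only [hkey]
    rw [integral_fourier_mul_eq (g := fun y => g (S^[l] y) * (starRingEnd ℂ) (g (S^[k] y)))
      hind _ ((hgk l).mul (Complex.continuous_conj.measurable.comp (hgk k))),
      integral_fourier_eq_zero hlk, zero_mul]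
  · induction k with
    | zero => simp [W]
    | succ k ih =>
      rw [← ih]
      conv_rhs => rw [← hξinv.map_eq]
      rw [integral_map hξinv.aemeasurable (hW k).aestronglyMeasurable]
      refine integral_congr_ae (ae_of_all _ fun p => ?_)
      have h1 : m + ((k + 1 : ℕ) : ℤ) * n = (m + k * n) + n := by push_cast; ring
      have h2 : (fourier n (p.1.2 + p.1.1) : ℂ) = fourier n p.1.2 * fourier n p.1.1 := by
        simp [fourier_apply, smul_add, AddCircle.toCircle_add]
      simp only [W, torusT, Function.iterate_succ_apply]
      rw [h1, h2, fourier_add (m := m + k * n)]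
      ring

end Joining

/-- The product Lebesgue (Haar) measure on the torus, invariant under
`T(t,s) = (t, s+t)`, is disjoint in the sense of Furstenberg from every ergodic
measure-preserving system: every joining equals the product measure. -/
theorem stmt19 (Y : Type*) [MeasurableSpace Y] (S : Y → Y) (ν : Measure Y)
    (hνp : IsProbabilityMeasure ν) (hS : Ergodic S ν)
    (ξ : Measure ((UnitAddCircle × UnitAddCircle) × Y)) (hξp : IsProbabilityMeasure ξ)
    (hξinv : MeasurePreserving (fun p => (torusT p.1, S p.2)) ξ ξ)
    (hfst : ξ.map Prod.fst = (volume : Measure (UnitAddCircle × UnitAddCircle)))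
    (hsnd : ξ.map Prod.snd = ν) :
    ξ = (volume : Measure (UnitAddCircle × UnitAddCircle)).prod ν := by
  have hind := map_fst_fst_snd_eq_prod hS hξinv hfst hsnd
  refine (Measure.prod_eq fun A B hA hB => ?_).symm
  let g : Y → ℂ := B.indicator 1
  have hg : Measurable g := measurable_one.indicator hB
  have hg1 (y : Y) : ‖g y‖ ≤ 1 := by
    by_cases hy : y ∈ B <;> simp [g, hy]
  have hgν : ∫ y, g y ∂ν = ν.real B := by
    simp [g, integral_indicator hB]
  have key : (ξ.restrict (Prod.snd ⁻¹' B)).map Prod.fst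
      = ν B • (volume : Measure (UnitAddCircle × UnitAddCircle)) := by
    have hfin : IsFiniteMeasure (ν B • (volume : Measure (UnitAddCircle × UnitAddCircle))) :=
      Measure.smul_finite _ (measure_ne_top _ _)
    refine ext_of_forall_integral_fourier_mul_fourier fun m n => ?_
    have hlhs : ∫ p, fourier m p.1 * fourier n p.2 ∂(ξ.restrict (Prod.snd ⁻¹' B)).map Prod.fst
        = ∫ p, fourier m p.1.1 * fourier n p.1.2 * g p.2 ∂ξ := by
      rw [integral_map measurable_fst.aemeasurable (by fun_prop),
        ← integral_indicator (measurable_snd hB)]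
      refine integral_congr_ae (ae_of_all _ fun p => ?_)
      by_cases hp : p.2 ∈ B <;> simp [g, hp]
    have hrhs : ∫ p : UnitAddCircle × UnitAddCircle, fourier m p.1 * fourier n p.2
        = (∫ t : UnitAddCircle, fourier m t) * ∫ s : UnitAddCircle, fourier n s :=
      integral_prod_mul _ _
    rw [hlhs, integral_smul_measure, hrhs]
    rcases eq_or_ne n 0 with rfl | hn
    · simp only [fourier_zero, mul_one]
      rw [integral_fourier_mul_eq hind m hg, hgν]
      simp [mul_comm, Measure.real]
    · rw [integral_fourier_mul_fourier_mul_eq_zero hS.measurable hξinv hind m hn hg hg1,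
        integral_fourier_eq_zero hn]
      simp
  have h := congrArg (· A) key
  simp only [Measure.map_apply measurable_fst hA, Measure.restrict_apply (measurable_fst hA),
    Measure.smul_apply, smul_eq_mul] at h
  rw [mul_comm, ← h]
  rfl
end
end
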